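/- Let $A \subseteq S^{n-1}$ be measurable with $\sigma(A) > 0$, and let $H$ be a uniformly random $(n-1)$-dimensional subspace of $\mathbb{R}^n$. Then for any $0 < t < 1$, $\Pr\left[\left|\frac{\sigma_H(A \cap H)}{\sigma(A)} - 1\right| \geq t\right] \leq C\exp\left(-\frac{cnt}{\log(2/\sigma(A))}\right)$ for universal constants $C, c > 0$. -/

import Mathlib

open MeasureTheory Metric

/-- The uniform (rotation-invariant) probability measure on the unit sphere
`S^{n-1} ⊂ ℝⁿ`. -/
noncomputable def uSphere (n : ℕ) : Measure (sphere (0 : EuclideanSpace ℝ (Fin n)) 1) :=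
  ((volume : Measure (EuclideanSpace ℝ (Fin n))).toSphere Set.univ)⁻¹ •
    (volume : Measure (EuclideanSpace ℝ (Fin n))).toSphere

/-- The map between unit spheres induced by a linear isometry. -/
noncomputable def sphereMap {m n : ℕ}
    (e : EuclideanSpace ℝ (Fin m) →ₗᵢ[ℝ] EuclideanSpace ℝ (Fin n))
    (ω : sphere (0 : EuclideanSpace ℝ (Fin m)) 1) :
    sphere (0 : EuclideanSpace ℝ (Fin n)) 1 :=
  ⟨e ω, by
    have hω : ‖(ω : EuclideanSpace ℝ (Fin m))‖ = 1 := mem_sphere_zero_iff_norm.mp ω.2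
    simp [mem_sphere_zero_iff_norm, e.norm_map, hω]⟩

/-- The average of `f : S^{n-1} → ℝ` over the equator parametrized by the linear
isometry `e : ℝ^{n-1} → ℝⁿ` (whose range is the hyperplane orthogonal to a point). -/
noncomputable def equatorAvg {n : ℕ} (f : sphere (0 : EuclideanSpace ℝ (Fin n)) 1 → ℝ)
    (e : EuclideanSpace ℝ (Fin (n - 1)) →ₗᵢ[ℝ] EuclideanSpace ℝ (Fin n)) : ℝ :=
  ∫ ω, f (sphereMap e ω) ∂uSphere (n - 1)

section PolynomialLaplacian
open MvPolynomial

noncomputable def polyLaplacian {n : ℕ} (P : MvPolynomial (Fin n) ℝ) : MvPolynomial (Fin n) ℝ :=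
  ∑ i, pderiv i (pderiv i P)

variable {n : ℕ}

theorem polyLaplacian_add (P Q : MvPolynomial (Fin n) ℝ) :
    polyLaplacian (P + Q) = polyLaplacian P + polyLaplacian Q := by
  simp [polyLaplacian, Finset.sum_add_distrib]

theorem polyLaplacian_smul (c : ℝ) (P : MvPolynomial (Fin n) ℝ) :
    polyLaplacian (c • P) = c • polyLaplacian P := by
  simp [polyLaplacian, Finset.smul_sum]

theorem polyLaplacian_sum {ι : Type*} (s : Finset ι) (P : ι → MvPolynomial (Fin n) ℝ) :
    polyLaplacian (∑ i ∈ s, P i) = ∑ i ∈ s, polyLaplacian (P i) := by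
  simp only [polyLaplacian, map_sum]
  exact Finset.sum_comm

theorem polyLaplacian_mul (P Q : MvPolynomial (Fin n) ℝ) :
    polyLaplacian (P * Q)
      = polyLaplacian P * Q + 2 * ∑ i, pderiv i P * pderiv i Q + P * polyLaplacian Q := by
  simp only [polyLaplacian, Finset.mul_sum, Finset.sum_mul, ← Finset.sum_add_distrib]
  refine Finset.sum_congr rfl fun i _ => ?_
  simp only [Derivation.leibniz, map_add, smul_eq_mul]
  ring

theorem pderiv_pderiv_comm (i j : Fin n) (P : MvPolynomial (Fin n) ℝ) :
    pderiv i (pderiv j P) = pderiv j (pderiv i P) := by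
  have h : ⁅pderiv (R := ℝ) i, pderiv (R := ℝ) j⁆ = 0 := by
    apply derivation_ext
    intro k
    simp only [Derivation.commutator_apply, pderiv_X, Derivation.coe_zero, Pi.zero_apply]
    simp only [Pi.single_apply]
    split_ifs <;> simp
  have := congrArg (fun D => D P) h
  simpa [Derivation.commutator_apply, sub_eq_zero] using this

theorem polyLaplacian_pderiv (i : Fin n) (P : MvPolynomial (Fin n) ℝ) :
    polyLaplacian (pderiv i P) = pderiv i (polyLaplacian P) := by
  simp only [polyLaplacian, map_sum]
  refine Finset.sum_congr rfl fun j _ => ?_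
  rw [pderiv_pderiv_comm j i P, pderiv_pderiv_comm j i]

theorem isHomogeneous_polyLaplacian {P : MvPolynomial (Fin n) ℝ} {d : ℕ} (h : P.IsHomogeneous d) :
    (polyLaplacian P).IsHomogeneous (d - 2) :=
  IsHomogeneous.sum _ _ _ fun _ _ => h.pderiv.pderiv

end PolynomialLaplacian

section GaussianIntegral
open MvPolynomial

variable {n : ℕ}

theorem hasLineDerivAt_eval (P : MvPolynomial (Fin n) ℝ) (i : Fin n) (x : Fin n → ℝ) :
    HasLineDerivAt ℝ (fun y => eval y P) (eval x (pderiv i P)) x (Pi.single i 1) := by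
  unfold HasLineDerivAt
  induction P using MvPolynomial.induction_on with
  | C a => simpa using hasDerivAt_const (0 : ℝ) a
  | add P Q hP hQ => simpa using hP.fun_add hQ
  | mul_X P j hP =>
    have hj : HasDerivAt (fun t : ℝ => (x + t • (Pi.single i (1 : ℝ) : Fin n → ℝ)) j)
        ((Pi.single i (1 : ℝ) : Fin n → ℝ) j) 0 := by
      simpa using ((hasDerivAt_id (0 : ℝ)).mul_const ((Pi.single i (1 : ℝ) : Fin n → ℝ) j)).const_add
        (x j)
    simp only [map_mul, eval_X, Derivation.leibniz, smul_eq_mul, map_add, pderiv_X]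
    refine (hP.fun_mul hj).congr_deriv ?_
    simp only [zero_smul, add_zero, Pi.single_apply]
    split_ifs <;> simp <;> ring

/-- The unnormalised standard Gaussian density on `Fin n → ℝ`. -/
noncomputable def gaussianWeight (x : Fin n → ℝ) : ℝ := Real.exp (-(∑ i, x i ^ 2) / 2)

theorem integrable_eval_mul_gaussianWeight (P : MvPolynomial (Fin n) ℝ) :
    Integrable (fun x : Fin n → ℝ => eval x P * gaussianWeight x) := by
  induction P using MvPolynomial.induction_on' with
  | add P Q hP hQ => exact (hP.add hQ).congr (.of_forall fun x => by simp [add_mul])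
  | monomial s a =>
    have h1 : ∀ k : ℕ, Integrable (fun t : ℝ => t ^ k * Real.exp (-(t ^ 2) / 2)) := by
      intro k
      have := integrable_rpow_mul_exp_neg_mul_sq (b := 1 / 2) (by norm_num) (s := k)
        (by have : (0 : ℝ) ≤ k := k.cast_nonneg
            linarith)
      simp only [Real.rpow_natCast] at this
      refine this.congr (.of_forall fun t => ?_)
      simp only
      congr 2
      ring
    have h2 := (Integrable.fintype_prod (fun i => h1 (s i))).const_mul a
    refine h2.congr (.of_forall fun x => ?_)
    simp only [eval_monomial, gaussianWeight, Finsupp.prod_fintype _ _ (fun i => pow_zero (x i)),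
      Finset.prod_mul_distrib, ← Real.exp_sum, Finset.sum_div, ← Finset.sum_neg_distrib, neg_div]
    ring

theorem hasLineDerivAt_gaussianWeight (i : Fin n) (x : Fin n → ℝ) :
    HasLineDerivAt ℝ gaussianWeight (-(x i * gaussianWeight x)) x (Pi.single i 1) := by
  have h := hasLineDerivAt_eval (∑ j, X j ^ 2 : MvPolynomial (Fin n) ℝ) i x
  unfold HasLineDerivAt at h ⊢
  simp only [map_sum, map_pow, eval_X] at h
  have h2 := (h.fun_neg.div_const 2).exp
  unfold gaussianWeight
  refine h2.congr_deriv ?_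
  simp [Derivation.leibniz_pow, pderiv_X, Pi.single_apply, apply_ite (eval x)]
  ring

theorem integral_pderiv_mul_gaussianWeight (P : MvPolynomial (Fin n) ℝ) (i : Fin n) :
    ∫ x, eval x (pderiv i P) * gaussianWeight x = ∫ x, eval x (X i * P) * gaussianWeight x := by
  have key := integral_bilinear_hasLineDerivAt_right_eq_neg_left_of_integrable
    (μ := (volume : Measure (Fin n → ℝ))) (B := ContinuousLinearMap.mul ℝ ℝ)
    (f := fun x => eval x P * gaussianWeight x)
    (f' := fun x => eval x (pderiv i P) * gaussianWeight x - eval x (X i * P) * gaussianWeight x)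
    (g := fun _ => 1) (g' := fun _ => 0) (v := Pi.single i 1)
    (((integrable_eval_mul_gaussianWeight (pderiv i P)).sub
      (integrable_eval_mul_gaussianWeight (X i * P))).congr (.of_forall fun x => by simp))
    (by simp) (by simpa using integrable_eval_mul_gaussianWeight P)
    (fun x _ => by
      have h1 := hasLineDerivAt_eval P i x
      have h2 := hasLineDerivAt_gaussianWeight i x
      unfold HasLineDerivAt at *
      refine (h1.fun_mul h2).congr_deriv ?_
      simp
      ring)
    (fun x _ => by simpa [HasLineDerivAt] using hasDerivAt_const (0 : ℝ) (1 : ℝ))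
  simp only [ContinuousLinearMap.mul_apply', mul_zero, integral_zero, mul_one] at key
  rw [integral_sub (integrable_eval_mul_gaussianWeight _)
    (integrable_eval_mul_gaussianWeight _)] at key
  linarith

theorem integral_polyLaplacian_mul_gaussianWeight {P : MvPolynomial (Fin n) ℝ} {d : ℕ}
    (hP : P.IsHomogeneous d) :
    ∫ x, eval x (polyLaplacian P) * gaussianWeight x
      = d * ∫ x, eval x P * gaussianWeight x := by
  have h1 : ∀ x : Fin n → ℝ, eval x (polyLaplacian P) * gaussianWeight x
      = ∑ i, eval x (pderiv i (pderiv i P)) * gaussianWeight x := by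
    intro x; simp [polyLaplacian, Finset.sum_mul]
  simp_rw [h1]
  rw [integral_finsetSum _ fun i _ => integrable_eval_mul_gaussianWeight _]
  simp_rw [integral_pderiv_mul_gaussianWeight]
  rw [← integral_finsetSum _ fun i _ => integrable_eval_mul_gaussianWeight _,
    ← integral_const_mul]
  refine integral_congr_ae (.of_forall fun x => ?_)
  simp only
  rw [← Finset.sum_mul, ← map_sum, hP.sum_X_mul_pderiv]
  simp [mul_assoc]

end GaussianIntegral

section SphereIntegral
open MvPolynomial

variable {n : ℕ}

/-- Restriction of polynomials to the unit sphere. -/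
noncomputable def sphereEval (n : ℕ) :
    MvPolynomial (Fin n) ℝ →ₐ[ℝ] C(sphere (0 : EuclideanSpace ℝ (Fin n)) 1, ℝ) :=
  aeval fun i => ⟨fun x => (x : EuclideanSpace ℝ (Fin n)) i, by fun_prop⟩

theorem sphereEval_apply (P : MvPolynomial (Fin n) ℝ)
    (x : sphere (0 : EuclideanSpace ℝ (Fin n)) 1) :
    sphereEval n P x = eval (x : EuclideanSpace ℝ (Fin n)).ofLp P := by
  induction P using MvPolynomial.induction_on with
  | C a => simp [sphereEval]
  | add P Q hP hQ => simp [hP, hQ]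
  | mul_X P j hP =>
    rw [map_mul, ContinuousMap.mul_apply, hP]
    simp [sphereEval]

theorem eval_smul_of_isHomogeneous {P : MvPolynomial (Fin n) ℝ} {d : ℕ} (hP : P.IsHomogeneous d)
    (r : ℝ) (x : Fin n → ℝ) : eval (r • x) P = r ^ d * eval x P := by
  rw [eval_eq', eval_eq', Finset.mul_sum]
  refine Finset.sum_congr rfl fun s hs => ?_
  have hd : ∑ i, s i = d := by
    rw [← Finsupp.degree_eq_sum, Finsupp.degree_eq_weight_one]
    exact hP (mem_support_iff.mp hs)
  simp only [Pi.smul_apply, smul_eq_mul, mul_pow, Finset.prod_mul_distrib,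
    Finset.prod_pow_eq_pow_sum, hd]
  ring

/-- Radial moments of the Gaussian weight. -/
noncomputable def radialMoment (m : ℕ) : ℝ :=
  ∫ r in Set.Ioi (0 : ℝ), r ^ m * Real.exp (-r ^ 2 / 2)

theorem radialMoment_eq (m : ℕ) :
    radialMoment m = 2 ^ (((m : ℝ) - 1) / 2) * Real.Gamma ((m + 1) / 2) := by
  have h := integral_rpow_mul_exp_neg_mul_rpow (p := 2) (q := m) (b := 1 / 2) (by norm_num)
    (by have : (0 : ℝ) ≤ m := m.cast_nonneg
        linarith) (by norm_num)
  unfold radialMoment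
  have h1 : ∀ r : ℝ, r ^ m * Real.exp (-r ^ 2 / 2)
      = r ^ (m : ℝ) * Real.exp (-(1 / 2) * r ^ (2 : ℝ)) := by
    intro r
    rw [Real.rpow_natCast, Real.rpow_two]
    congr 2; ring
  simp_rw [h1, h]
  rw [one_div, Real.inv_rpow (by norm_num), ← Real.rpow_neg (by norm_num)]
  have : (2 : ℝ) ^ (((m : ℝ) - 1) / 2) = 2 ^ (-(-((m : ℝ) + 1) / 2)) * 2⁻¹ := by
    rw [← Real.rpow_neg_one 2, ← Real.rpow_add (by norm_num)]
    congr 1; ring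
  rw [this]

theorem radialMoment_pos (m : ℕ) : 0 < radialMoment m := by
  rw [radialMoment_eq]
  have := Real.Gamma_pos_of_pos (s := ((m : ℝ) + 1) / 2) (by positivity)
  positivity

theorem radialMoment_add_two (m : ℕ) : radialMoment (m + 2) = (m + 1) * radialMoment m := by
  rw [radialMoment_eq, radialMoment_eq]
  push_cast
  rw [show ((m : ℝ) + 2 + 1) / 2 = (m + 1) / 2 + 1 by ring, Real.Gamma_add_one (by positivity),
    show ((m : ℝ) + 2 - 1) / 2 = (m - 1) / 2 + 1 by ring, Real.rpow_add_one (by norm_num)]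
  ring

theorem gaussianWeight_ofLp (x : EuclideanSpace ℝ (Fin n)) :
    gaussianWeight x.ofLp = Real.exp (-‖x‖ ^ 2 / 2) := by
  rw [gaussianWeight, EuclideanSpace.norm_sq_eq]
  simp

theorem integral_eval_mul_gaussianWeight [NeZero n] {P : MvPolynomial (Fin n) ℝ} {d : ℕ}
    (hP : P.IsHomogeneous d) :
    ∫ x, eval x P * gaussianWeight x
      = (∫ x, sphereEval n P x ∂(volume : Measure (EuclideanSpace ℝ (Fin n))).toSphere)
        * radialMoment (n - 1 + d) := by
  set μ := (volume : Measure (EuclideanSpace ℝ (Fin n)))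
  set F : EuclideanSpace ℝ (Fin n) → ℝ := fun x => eval x.ofLp P * Real.exp (-‖x‖ ^ 2 / 2)
  calc ∫ x, eval x P * gaussianWeight x
      = ∫ x, F x := by
        rw [← (PiLp.volume_preserving_ofLp (Fin n)).integral_comp
          (MeasurableEquiv.toLp 2 (Fin n → ℝ)).symm.measurableEmbedding]
        simp only [gaussianWeight_ofLp, F]
    _ = ∫ x : ({0}ᶜ : Set (EuclideanSpace ℝ (Fin n))), F x ∂(μ.comap (↑)) := by
        rw [integral_subtype_comap (measurableSet_singleton _).compl F,
          restrict_compl_singleton]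
    _ = ∫ z, sphereEval n P z.1 * (z.2.1 ^ d * Real.exp (-z.2.1 ^ 2 / 2))
          ∂μ.toSphere.prod (.volumeIoiPow (Module.finrank ℝ (EuclideanSpace ℝ (Fin n)) - 1)) := by
        rw [← μ.measurePreserving_homeomorphUnitSphereProd.integral_comp
          (Homeomorph.measurableEmbedding _)]
        refine integral_congr_ae (.of_forall fun x => ?_)
        have hx : ‖(x : EuclideanSpace ℝ (Fin n))‖ ≠ 0 := by
          exact norm_ne_zero_iff.mpr x.2
        have hx2 : (x : EuclideanSpace ℝ (Fin n)).ofLp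
            = ‖(x : EuclideanSpace ℝ (Fin n))‖ •
              (‖(x : EuclideanSpace ℝ (Fin n))‖⁻¹ • (x : EuclideanSpace ℝ (Fin n)).ofLp) := by
          rw [smul_smul, mul_inv_cancel₀ hx, one_smul]
        simp only [F, sphereEval_apply, homeomorphUnitSphereProd_apply_snd_coe,
          homeomorphUnitSphereProd_apply_fst_coe, WithLp.ofLp_smul]
        rw [hx2, eval_smul_of_isHomogeneous hP, ← hx2]
        ring
    _ = _ := by
        refine (integral_prod_mul (fun x => sphereEval n P x)
          (fun r : Set.Ioi (0 : ℝ) => r.1 ^ d * Real.exp (-r.1 ^ 2 / 2))).trans ?_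
        congr 1
        simp only [Measure.volumeIoiPow, ENNReal.ofReal]
        rw [integral_withDensity_eq_integral_smul,
          integral_subtype_comap measurableSet_Ioi fun a : ℝ => Real.toNNReal (a ^ (_ - 1)) •
            (a ^ d * Real.exp (-a ^ 2 / 2)), radialMoment,
          setIntegral_congr_fun measurableSet_Ioi fun x hx => ?_]
        · rw [NNReal.smul_def, Real.coe_toNNReal _ (pow_nonneg hx.out.le _)]
          simp [pow_add, mul_assoc]
        · exact (measurable_subtype_coe.pow_const _).real_toNNReal

theorem toSphere_integral_polyLaplacian [NeZero n] {P : MvPolynomial (Fin n) ℝ} {d : ℕ}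
    (hP : P.IsHomogeneous d) :
    ∫ x, sphereEval n (polyLaplacian P) x ∂(volume : Measure (EuclideanSpace ℝ (Fin n))).toSphere
      = d * (d + n - 2) *
        ∫ x, sphereEval n P x ∂(volume : Measure (EuclideanSpace ℝ (Fin n))).toSphere := by
  have h := integral_polyLaplacian_mul_gaussianWeight hP
  rw [integral_eval_mul_gaussianWeight (isHomogeneous_polyLaplacian hP),
    integral_eval_mul_gaussianWeight hP] at h
  have hn : 1 ≤ n := NeZero.one_le
  match d, hP, h with
  | 0, hP, h =>
    have := (radialMoment_pos (n - 1 + (0 - 2))).ne'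
    simp only [Nat.cast_zero, zero_mul, mul_eq_zero, this, or_false] at h ⊢
    exact h
  | 1, hP, h =>
    have h0 : polyLaplacian P = 0 := by
      refine Finset.sum_eq_zero fun i _ => ?_
      have : (pderiv i P).IsHomogeneous 0 := hP.pderiv
      rw [totalDegree_eq_zero_iff_eq_C.mp (Nat.le_zero.mp this.totalDegree_le), pderiv_C]
    have := (radialMoment_pos (n - 1 + 1)).ne'
    simp only [h0, map_zero, ContinuousMap.zero_apply, integral_zero, zero_mul, Nat.cast_one,
      one_mul] at h ⊢
    have h1 := h.symm
    simp only [mul_eq_zero, this, or_false] at h1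
    rw [h1, mul_zero]
  | d + 2, hP, h =>
    rw [show n - 1 + (d + 2) = (n - 1 + d) + 2 by ring, radialMoment_add_two] at h
    have := (radialMoment_pos (n - 1 + d)).ne'
    simp only [Nat.add_sub_cancel] at h
    apply mul_right_cancel₀ this
    rw [h]
    push_cast [Nat.cast_sub hn]
    ring

instance isProbabilityMeasure_uSphere [NeZero n] : IsProbabilityMeasure (uSphere n) := by
  constructor
  have h0 : (volume : Measure (EuclideanSpace ℝ (Fin n))).toSphere Set.univ ≠ 0 := by
    rw [Measure.measure_univ_ne_zero]
    exact Measure.toSphere_ne_zero _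
  rw [uSphere, Measure.smul_apply, smul_eq_mul, ENNReal.inv_mul_cancel h0 (measure_ne_top _ _)]

theorem integral_polyLaplacian [NeZero n] {P : MvPolynomial (Fin n) ℝ} {d : ℕ}
    (hP : P.IsHomogeneous d) :
    ∫ x, sphereEval n (polyLaplacian P) x ∂uSphere n
      = d * (d + n - 2) * ∫ x, sphereEval n P x ∂uSphere n := by
  rw [uSphere, integral_smul_measure, integral_smul_measure, toSphere_integral_polyLaplacian hP]
  simp only [smul_eq_mul]
  ring

end SphereIntegral

section SphereMean
open MvPolynomial

variable {n : ℕ} [NeZero n]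

theorem integrable_continuousMap_uSphere (f : C(sphere (0 : EuclideanSpace ℝ (Fin n)) 1, ℝ)) :
    Integrable f (uSphere n) :=
  f.continuous.integrable_of_hasCompactSupport (HasCompactSupport.of_compactSpace _)

/-- The mean of a polynomial over the unit sphere. -/
noncomputable def sphereMean (n : ℕ) [NeZero n] : MvPolynomial (Fin n) ℝ →ₗ[ℝ] ℝ where
  toFun P := ∫ x, sphereEval n P x ∂uSphere n
  map_add' P Q := by
    simp only [map_add, ContinuousMap.add_apply]
    exact integral_add (integrable_continuousMap_uSphere _) (integrable_continuousMap_uSphere _)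
  map_smul' c P := by
    simp only [map_smul, ContinuousMap.smul_apply, RingHom.id_apply]
    exact integral_smul _ _

theorem sphereMean_apply (P : MvPolynomial (Fin n) ℝ) :
    sphereMean n P = ∫ x, sphereEval n P x ∂uSphere n := rfl

theorem sphereMean_C (c : ℝ) : sphereMean n (C c) = c := by
  simp [sphereMean_apply]

theorem sphereMean_mono {P Q : MvPolynomial (Fin n) ℝ} (h : ∀ x, eval x P ≤ eval x Q) :
    sphereMean n P ≤ sphereMean n Q :=
  integral_mono (integrable_continuousMap_uSphere _) (integrable_continuousMap_uSphere _)
    fun x => by simpa only [sphereEval_apply] using h _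

theorem sphereMean_nonneg {P : MvPolynomial (Fin n) ℝ} (h : ∀ x, 0 ≤ eval x P) :
    0 ≤ sphereMean n P := by
  simpa using sphereMean_mono (n := n) (P := 0) (Q := P) (by simpa using h)

theorem sphereMean_polyLaplacian {P : MvPolynomial (Fin n) ℝ} {d : ℕ} (hP : P.IsHomogeneous d) :
    sphereMean n (polyLaplacian P) = d * (d + n - 2) * sphereMean n P :=
  integral_polyLaplacian hP

end SphereMean

section Harmonic
open MvPolynomial

variable {n : ℕ}

/-- Homogeneous harmonic polynomials of degree `k`. -/
structure IsSolidHarmonic (k : ℕ) (P : MvPolynomial (Fin n) ℝ) : Prop where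
  isHomogeneous : P.IsHomogeneous k
  polyLaplacian_eq_zero : polyLaplacian P = 0

theorem IsSolidHarmonic.pderiv {k : ℕ} {P : MvPolynomial (Fin n) ℝ} (h : IsSolidHarmonic k P)
    (i : Fin n) : IsSolidHarmonic (k - 1) (MvPolynomial.pderiv i P) :=
  ⟨h.isHomogeneous.pderiv, by rw [polyLaplacian_pderiv, h.polyLaplacian_eq_zero, map_zero]⟩

theorem eq_C_of_isHomogeneous_zero {P : MvPolynomial (Fin n) ℝ} (hP : P.IsHomogeneous 0) :
    P = C (coeff 0 P) :=
  totalDegree_eq_zero_iff_eq_C.mp (Nat.le_zero.mp hP.totalDegree_le)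

theorem sphereMean_mul_eq_zero_of_lt (hn : 2 ≤ n) [NeZero n] {k l : ℕ} (hkl : k < l)
    {P Q : MvPolynomial (Fin n) ℝ} (hP : IsSolidHarmonic k P) (hQ : IsSolidHarmonic l Q) :
    sphereMean n (P * Q) = 0 := by
  induction k generalizing l P Q with
  | zero =>
    have h := sphereMean_polyLaplacian (n := n) (hP.isHomogeneous.mul hQ.isHomogeneous)
    rw [polyLaplacian_mul, hP.polyLaplacian_eq_zero, hQ.polyLaplacian_eq_zero,
      eq_C_of_isHomogeneous_zero hP.isHomogeneous] at h
    simp only [pderiv_C, zero_mul, mul_zero, Finset.sum_const_zero, add_zero, map_zero] at h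
    rw [eq_C_of_isHomogeneous_zero hP.isHomogeneous]
    have hn' : (2 : ℝ) ≤ n := by exact_mod_cast hn
    have hl : (1 : ℝ) ≤ l := by exact_mod_cast hkl
    refine (mul_eq_zero.mp h.symm).resolve_left ?_
    push_cast
    have : (0 : ℝ) < (0 + l) * (0 + l + n - 2) := mul_pos (by linarith) (by linarith)
    exact this.ne'
  | succ k ih =>
    have h := sphereMean_polyLaplacian (n := n) (hP.isHomogeneous.mul hQ.isHomogeneous)
    rw [polyLaplacian_mul, hP.polyLaplacian_eq_zero, hQ.polyLaplacian_eq_zero, zero_mul, mul_zero,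
      zero_add, add_zero, two_mul, map_add, map_sum,
      Finset.sum_eq_zero fun i _ => ih (by omega : k < l - 1) (hP.pderiv i) (hQ.pderiv i)] at h
    have hn' : (2 : ℝ) ≤ n := by exact_mod_cast hn
    have hl : (1 : ℝ) ≤ l := by exact_mod_cast (by omega : 1 ≤ l)
    refine (mul_eq_zero.mp ((add_zero (0 : ℝ)).symm.trans h).symm).resolve_left ?_
    push_cast
    have : (0 : ℝ) < (k + 1 + l) * (k + 1 + l + n - 2) := mul_pos (by positivity) (by
      have : (0 : ℝ) ≤ k := k.cast_nonneg
      linarith)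
    exact this.ne'

theorem sphereMean_mul_eq_zero (hn : 2 ≤ n) [NeZero n] {k l : ℕ} (hkl : k ≠ l)
    {P Q : MvPolynomial (Fin n) ℝ} (hP : IsSolidHarmonic k P) (hQ : IsSolidHarmonic l Q) :
    sphereMean n (P * Q) = 0 := by
  rcases hkl.lt_or_gt with h | h
  · exact sphereMean_mul_eq_zero_of_lt hn h hP hQ
  · rw [mul_comm]
    exact sphereMean_mul_eq_zero_of_lt hn h hQ hP

theorem succ_mul_pow_mul_le {a b : ℝ} (ha : 0 ≤ a) (hb : 0 ≤ b) (q : ℕ) :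
    (q + 1) * a ^ q * b ≤ q * a ^ (q + 1) + b ^ (q + 1) := by
  induction q with
  | zero => simp
  | succ q ih =>
    have h1 := mul_le_mul_of_nonneg_right ih hb
    have h2 : 0 ≤ (q + 1) * a ^ q * (a - b) ^ 2 := by positivity
    push_cast
    calc ((q : ℝ) + 1 + 1) * a ^ (q + 1) * b
        = (q + 1) * a ^ q * b * b - (q * a ^ (q + 1)) * b + (q + 1) * a ^ (q + 1 + 1)
          - (q + 1) * a ^ q * (a - b) ^ 2 := by ring
      _ ≤ (q + 1) * a ^ (q + 1 + 1) + b ^ (q + 1 + 1) := by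
        have : b ^ (q + 1 + 1) = b ^ (q + 1) * b := pow_succ _ _
        nlinarith

theorem polyLaplacian_pow_succ (S : MvPolynomial (Fin n) ℝ) (q : ℕ) :
    polyLaplacian (S ^ (q + 1)) = (q + 1 : ℝ) • (S ^ q * polyLaplacian S)
      + ((q + 1) * q : ℝ) • (S ^ (q - 1) * ∑ j, pderiv j S ^ 2) := by
  simp only [polyLaplacian, Finset.mul_sum, Finset.smul_sum, ← Finset.sum_add_distrib]
  refine Finset.sum_congr rfl fun i _ => ?_
  simp only [Derivation.leibniz_pow, Derivation.leibniz, Nat.add_sub_cancel, smul_eq_mul,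
    nsmul_eq_mul, smul_eq_C_mul, map_add, map_mul, map_natCast, map_one, Nat.cast_add,
    Nat.cast_one, Derivation.map_natCast, Derivation.map_one_eq_zero]
  ring

theorem hypercontractivity [NeZero n] (hn : 2 ≤ n) (k q : ℕ) {ι : Type} [Fintype ι]
    (Q : ι → MvPolynomial (Fin n) ℝ) (hQ : ∀ i, IsSolidHarmonic k (Q i)) :
    sphereMean n ((∑ i, Q i ^ 2) ^ (q + 1))
      ≤ ((2 * q + 1) ^ k * sphereMean n (∑ i, Q i ^ 2)) ^ (q + 1) := by
  induction k generalizing ι with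
  | zero =>
    have : ∑ i, Q i ^ 2 = C (∑ i, coeff 0 (Q i) ^ 2) := by
      rw [map_sum]
      refine Finset.sum_congr rfl fun i _ => ?_
      rw [map_pow, ← eq_C_of_isHomogeneous_zero (hQ i).isHomogeneous]
    rw [this, ← map_pow, sphereMean_C, sphereMean_C]
    simp
  | succ k ih =>
    set S := ∑ i, Q i ^ 2 with hS
    set S' := ∑ ij : ι × Fin n, pderiv ij.2 (Q ij.1) ^ 2 with hS'
    have ih' := ih (fun ij : ι × Fin n => pderiv ij.2 (Q ij.1)) fun ij => (hQ ij.1).pderiv ij.2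
    rw [← hS'] at ih'
    have hS0 : ∀ x, 0 ≤ eval x S := fun x => by
      simp only [S, map_sum, map_pow]; positivity
    have hS'0 : ∀ x, 0 ≤ eval x S' := fun x => by
      simp only [S', map_sum, map_pow]; positivity
    have hSd : S.IsHomogeneous ((k + 1) * 2) :=
      IsHomogeneous.sum _ _ _ fun i _ => (hQ i).isHomogeneous.pow 2
    have hΔS : polyLaplacian S = (2 : ℝ) • S' := by
      rw [hS, polyLaplacian_sum, hS', Fintype.sum_prod_type, Finset.smul_sum]
      refine Finset.sum_congr rfl fun i _ => ?_
      rw [pow_two, polyLaplacian_mul, (hQ i).polyLaplacian_eq_zero]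
      simp only [zero_mul, mul_zero, zero_add, add_zero, smul_eq_C_mul, map_ofNat, pow_two]
    have hgrad : ∀ x, eval x (∑ j, pderiv j S ^ 2) ≤ 4 * eval x S * eval x S' := by
      intro x
      simp only [S, S', map_sum, map_pow, Fintype.sum_prod_type, Derivation.leibniz_pow,
        nsmul_eq_mul, smul_eq_mul, map_mul]
      rw [Finset.sum_comm (s := (Finset.univ : Finset ι)), Finset.mul_sum]
      refine Finset.sum_le_sum fun j _ => ?_
      have := Finset.sum_mul_sq_le_sq_mul_sq Finset.univ (fun i => eval x (Q i))
        (fun i => eval x (pderiv j (Q i)))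
      calc _ = 4 * (∑ i, eval x (Q i) * eval x (pderiv j (Q i))) ^ 2 := by
            rw [show (4 : ℝ) = 2 ^ 2 by norm_num, ← mul_pow, Finset.mul_sum]
            simp
        _ ≤ _ := by linarith
    have hΔ : ∀ x, eval x (polyLaplacian (S ^ (q + 1)))
        ≤ eval x ((2 * (q + 1) * (2 * q + 1) : ℝ) • (S ^ q * S')) := by
      intro x
      rw [polyLaplacian_pow_succ, hΔS]
      simp only [map_add, map_mul, map_pow, smul_eval]
      have h1 : (q : ℝ) * (eval x S ^ (q - 1) * eval x (∑ j, pderiv j S ^ 2))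
          ≤ 4 * q * (eval x S ^ q * eval x S') := by
        rcases q with _ | q
        · simp
        · have := mul_le_mul_of_nonneg_left (hgrad x) (pow_nonneg (hS0 x) q)
          have := mul_le_mul_of_nonneg_left this (Nat.cast_nonneg (α := ℝ) (q + 1))
          refine this.trans (le_of_eq ?_)
          ring
      have h2 := mul_le_mul_of_nonneg_left h1 (by positivity : (0 : ℝ) ≤ q + 1)
      linarith
    have hmean := sphereMean_mono (n := n) hΔ
    rw [sphereMean_polyLaplacian (hSd.pow (q + 1)), map_smul, smul_eq_mul] at hmean
    have hmean1 := sphereMean_polyLaplacian (n := n) hSd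
    rw [hΔS, map_smul, smul_eq_mul] at hmean1
    set c : ℝ := (k + 1) * (2 * (k + 1) + n - 2) with hc
    have hn' : (2 : ℝ) ≤ n := by exact_mod_cast hn
    have hc0 : 0 < c := mul_pos (by positivity) (by linarith [(k.cast_nonneg : (0 : ℝ) ≤ k)])
    have hES' : sphereMean n S' = c * sphereMean n S := by
      push_cast at hmean1
      rw [hc]
      linarith
    have hpow0 : 0 ≤ sphereMean n (S ^ (q + 1)) :=
      sphereMean_nonneg fun x => by simpa using pow_nonneg (hS0 x) _
    have hstep : c * sphereMean n (S ^ (q + 1)) ≤ (2 * q + 1) * sphereMean n (S ^ q * S') := by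
      have h1 : c * sphereMean n (S ^ (q + 1)) ≤
          ((k + 1) * (2 * (k + 1) * (q + 1) + n - 2)) * sphereMean n (S ^ (q + 1)) := by
        refine mul_le_mul_of_nonneg_right ?_ hpow0
        rw [hc]
        refine mul_le_mul_of_nonneg_left ?_ (by positivity)
        have : (0 : ℝ) ≤ 2 * (k + 1) * q := by positivity
        linarith
      push_cast at hmean
      have h2 : (0 : ℝ) < 2 * (q + 1) := by positivity
      refine h1.trans (le_of_mul_le_mul_left ?_ h2)
      linarith
    have hyoung : (q + 1) * sphereMean n ((c • S) ^ q * ((2 * q + 1 : ℝ) • S'))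
        ≤ q * sphereMean n ((c • S) ^ (q + 1)) + sphereMean n (((2 * q + 1 : ℝ) • S') ^ (q + 1)) := by
      have := sphereMean_mono (n := n)
        (P := (q + 1 : ℝ) • ((c • S) ^ q * ((2 * q + 1 : ℝ) • S')))
        (Q := (q : ℝ) • (c • S) ^ (q + 1) + ((2 * q + 1 : ℝ) • S') ^ (q + 1)) (fun x => by
          simp only [map_add, smul_eval, map_mul, map_pow]
          have := succ_mul_pow_mul_le (a := c * eval x S) (b := (2 * q + 1) * eval x S')
            (mul_nonneg hc0.le (hS0 x)) (mul_nonneg (by positivity) (hS'0 x)) q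
          linarith)
      simpa only [map_add, map_smul, smul_eq_mul] using this
    have e1 : sphereMean n ((c • S) ^ q * ((2 * q + 1 : ℝ) • S'))
        = c ^ q * ((2 * q + 1) * sphereMean n (S ^ q * S')) := by
      rw [smul_pow, smul_mul_smul_comm, map_smul, smul_eq_mul, mul_assoc]
    simp only [smul_pow, map_smul, smul_eq_mul] at hyoung e1
    rw [e1] at hyoung
    have h3 := mul_le_mul_of_nonneg_left hstep (pow_nonneg hc0.le q)
    have h4 : c ^ (q + 1) * sphereMean n (S ^ (q + 1))
        ≤ (2 * q + 1) ^ (q + 1) * sphereMean n (S' ^ (q + 1)) := by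
      have h5 := mul_le_mul_of_nonneg_left h3 (by positivity : (0 : ℝ) ≤ q + 1)
      have : c ^ (q + 1) = c ^ q * c := pow_succ _ _
      rw [this] at hyoung ⊢
      linarith
    rw [hES'] at ih'
    have h6 := mul_le_mul_of_nonneg_left ih' (by positivity : (0 : ℝ) ≤ (2 * q + 1) ^ (q + 1))
    refine le_of_mul_le_mul_left ((h4.trans h6).trans (le_of_eq ?_)) (pow_pos hc0 (q + 1))
    rw [← mul_pow, ← mul_pow]
    congr 1
    ring

end Harmonic

section Decomposition
open MvPolynomial

variable {n : ℕ}

/-- The polynomial `∑ Xᵢ²`. -/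
noncomputable def radiusSq (n : ℕ) : MvPolynomial (Fin n) ℝ := ∑ i, X i ^ 2

theorem isHomogeneous_radiusSq : (radiusSq n).IsHomogeneous 2 :=
  IsHomogeneous.sum _ _ _ fun i _ => by simpa using (isHomogeneous_X ℝ i).pow 2

theorem pderiv_radiusSq (j : Fin n) : pderiv j (radiusSq n) = 2 * X j := by
  rw [radiusSq, map_sum, Finset.sum_eq_single j]
  · simp [Derivation.leibniz_pow, two_mul]
  · intro i _ hi
    simp [Derivation.leibniz_pow, pderiv_X_of_ne hi]
  · simp

theorem polyLaplacian_radiusSq_pow_mul {k : ℕ} {h : MvPolynomial (Fin n) ℝ}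
    (hh : IsSolidHarmonic k h) (q : ℕ) :
    polyLaplacian (radiusSq n ^ (q + 1) * h)
      = (2 * (q + 1) * (2 * q + n + 2 * k) : ℝ) • (radiusSq n ^ q * h) := by
  have h1 : polyLaplacian (radiusSq n) = (2 * n : ℝ) • 1 := by
    simp only [polyLaplacian, pderiv_radiusSq]
    simp only [Derivation.leibniz, pderiv_X_self, smul_eq_mul, mul_one, Finset.sum_const,
      Finset.card_univ, Fintype.card_fin, nsmul_eq_mul, smul_eq_C_mul, Finset.sum_add_distrib]
    rw [show (2 : MvPolynomial (Fin n) ℝ) = C 2 from (map_ofNat C 2).symm]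
    simp [mul_comm]
  have h2 : ∑ j, pderiv j (radiusSq n) ^ 2 = (4 : ℝ) • radiusSq n := by
    simp only [pderiv_radiusSq, mul_pow, ← Finset.mul_sum]
    rw [smul_eq_C_mul, map_ofNat, radiusSq]
    norm_num
  have h3 : ∑ j, pderiv j (radiusSq n ^ (q + 1)) * pderiv j h
      = (2 * (q + 1) * k : ℝ) • (radiusSq n ^ q * h) := by
    have h4 := hh.isHomogeneous.sum_X_mul_pderiv
    calc _ = (2 * (q + 1) : ℝ) • (radiusSq n ^ q * ∑ i, X i * pderiv i h) := by
          rw [Finset.mul_sum, Finset.smul_sum]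
          refine Finset.sum_congr rfl fun j _ => ?_
          simp only [Derivation.leibniz_pow, pderiv_radiusSq, smul_eq_C_mul, nsmul_eq_mul,
            smul_eq_mul, Nat.add_sub_cancel, map_mul, map_ofNat, map_add, map_natCast, map_one,
            Nat.cast_add, Nat.cast_one]
          ring
      _ = _ := by
          rw [h4]
          simp only [smul_eq_C_mul, nsmul_eq_mul, map_mul, map_natCast]
          ring
  have h5 : (q : ℝ) • (radiusSq n ^ (q - 1) * radiusSq n) = (q : ℝ) • radiusSq n ^ q := by
    rcases q with _ | q
    · simp
    · rw [Nat.add_sub_cancel, pow_succ]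
  have h6 : polyLaplacian (radiusSq n ^ (q + 1))
      = (2 * (q + 1) * (2 * q + n) : ℝ) • radiusSq n ^ q := by
    rw [polyLaplacian_pow_succ, h1, h2, mul_smul_comm, mul_smul_comm, smul_smul, smul_smul, mul_one,
      show ((q : ℝ) + 1) * q * 4 = ((q + 1) * 4) * q by ring, mul_smul _ (q : ℝ), h5, smul_smul, ← add_smul]
    congr 1
    ring
  rw [polyLaplacian_mul, h6, h3, hh.polyLaplacian_eq_zero, mul_zero, add_zero, smul_mul_assoc,
    show (2 : MvPolynomial (Fin n) ℝ) = C 2 from (map_ofNat C 2).symm, ← smul_eq_C_mul, smul_smul, ← add_smul]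
  congr 1
  ring

theorem polyLaplacian_eq_zero_of_isHomogeneous {P : MvPolynomial (Fin n) ℝ} {d : ℕ}
    (hP : P.IsHomogeneous d) (hd : d ≤ 1) : polyLaplacian P = 0 := by
  refine Finset.sum_eq_zero fun i _ => ?_
  have : (pderiv i P).IsHomogeneous 0 := by
    simpa [Nat.sub_eq_zero_of_le hd] using hP.pderiv (i := i)
  rw [eq_C_of_isHomogeneous_zero this, pderiv_C]

/-- The Laplacian as a linear map. -/
noncomputable def polyLaplacianₗ (n : ℕ) : MvPolynomial (Fin n) ℝ →ₗ[ℝ] MvPolynomial (Fin n) ℝ where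
  toFun := polyLaplacian
  map_add' := polyLaplacian_add
  map_smul' := polyLaplacian_smul

theorem polyLaplacianₗ_apply (P : MvPolynomial (Fin n) ℝ) :
    polyLaplacianₗ n P = polyLaplacian P := rfl

theorem isHomogeneous_polyLaplacianₗ_pow {P : MvPolynomial (Fin n) ℝ} (m : ℕ) {d : ℕ}
    (hP : P.IsHomogeneous (2 * m + d)) : ((polyLaplacianₗ n ^ m) P).IsHomogeneous d := by
  induction m generalizing P with
  | zero => simpa using hP
  | succ m ih =>
    rw [pow_succ, Module.End.mul_apply, polyLaplacianₗ_apply]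
    refine ih ?_
    have := isHomogeneous_polyLaplacian hP
    rwa [show 2 * (m + 1) + d - 2 = 2 * m + d by omega] at this

theorem exists_polyLaplacianₗ_pow_radiusSq [NeZero n] {k : ℕ} {h : MvPolynomial (Fin n) ℝ}
    (hh : IsSolidHarmonic k h) (m : ℕ) :
    ∃ c : ℝ, c ≠ 0 ∧ (polyLaplacianₗ n ^ m) (radiusSq n ^ m * h) = c • h := by
  induction m with
  | zero => exact ⟨1, one_ne_zero, by simp⟩
  | succ m ih =>
    obtain ⟨c, hc, h1⟩ := ih
    have hn : (0 : ℝ) < n := by exact_mod_cast NeZero.pos n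
    refine ⟨(2 * (m + 1) * (2 * m + n + 2 * k)) * c, mul_ne_zero (by positivity) hc, ?_⟩
    rw [pow_succ, Module.End.mul_apply, polyLaplacianₗ_apply, polyLaplacian_radiusSq_pow_mul hh,
      map_smul, h1, smul_smul]

theorem sphereEval_radiusSq : sphereEval n (radiusSq n) = 1 := by
  ext x
  have := EuclideanSpace.norm_sq_eq (x : EuclideanSpace ℝ (Fin n))
  rw [mem_sphere_zero_iff_norm.mp x.2] at this
  simpa [sphereEval_apply, radiusSq] using this.symm

/-- Spherical harmonics of degree `k`, as continuous functions on the sphere. -/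
noncomputable def sphericalHarmonics (n k : ℕ) :
    Submodule ℝ C(sphere (0 : EuclideanSpace ℝ (Fin n)) 1, ℝ) :=
  (homogeneousSubmodule (Fin n) ℝ k ⊓ LinearMap.ker (polyLaplacianₗ n)).map
    (sphereEval n).toLinearMap

theorem mem_sphericalHarmonics {k : ℕ} {f : C(sphere (0 : EuclideanSpace ℝ (Fin n)) 1, ℝ)} :
    f ∈ sphericalHarmonics n k ↔ ∃ P, IsSolidHarmonic k P ∧ sphereEval n P = f := by
  simp only [sphericalHarmonics, Submodule.mem_map, Submodule.mem_inf, mem_homogeneousSubmodule,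
    LinearMap.mem_ker, polyLaplacianₗ_apply, AlgHom.toLinearMap_apply]
  exact ⟨fun ⟨P, h, e⟩ => ⟨P, ⟨h.1, h.2⟩, e⟩, fun ⟨P, h, e⟩ => ⟨P, ⟨h.1, h.2⟩, e⟩⟩

theorem sphereEval_mem_iSup_of_pow_eq_zero [NeZero n] (m : ℕ) {e : ℕ} {P : MvPolynomial (Fin n) ℝ}
    (hP : P.IsHomogeneous (2 * m + e)) (h0 : (polyLaplacianₗ n ^ (m + 1)) P = 0) :
    sphereEval n P ∈ ⨆ k, sphericalHarmonics n k := by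
  induction m generalizing e P with
  | zero =>
    exact Submodule.mem_iSup_of_mem e (mem_sphericalHarmonics.mpr
      ⟨P, ⟨by simpa using hP, by
        simpa [polyLaplacianₗ_apply] using h0⟩, rfl⟩)
  | succ m ih =>
    have hh : IsSolidHarmonic e ((polyLaplacianₗ n ^ (m + 1)) P) :=
      ⟨isHomogeneous_polyLaplacianₗ_pow _ hP, by
        rwa [pow_succ', Module.End.mul_apply] at h0⟩
    set h := (polyLaplacianₗ n ^ (m + 1)) P with hdef
    obtain ⟨c, hc, h1⟩ := exists_polyLaplacianₗ_pow_radiusSq hh (m + 1)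
    have h2 : sphereEval n (P - c⁻¹ • (radiusSq n ^ (m + 1) * h))
        ∈ ⨆ k, sphericalHarmonics n k := by
      refine ih (e := 2 + e) ?_ ?_
      · have h3 : (c⁻¹ • (radiusSq n ^ (m + 1) * h)).IsHomogeneous (2 * (m + 1) + e) := by
          rw [smul_eq_C_mul]
          exact ((isHomogeneous_radiusSq.pow (m + 1)).mul hh.isHomogeneous).C_mul _
        rw [show 2 * m + (2 + e) = 2 * (m + 1) + e by ring]
        exact hP.sub h3
      · rw [map_sub, map_smul, h1, smul_smul, inv_mul_cancel₀ hc, one_smul, sub_self]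
    have h4 : sphereEval n P = sphereEval n (P - c⁻¹ • (radiusSq n ^ (m + 1) * h))
        + c⁻¹ • sphereEval n h := by
      rw [map_sub, map_smul, map_mul, map_pow, sphereEval_radiusSq, one_pow, one_mul,
        sub_add_cancel]
    rw [h4]
    exact add_mem h2 (Submodule.smul_mem _ _ (Submodule.mem_iSup_of_mem e
      (mem_sphericalHarmonics.mpr ⟨h, hh, rfl⟩)))

theorem sphereEval_mem_iSup [NeZero n] (P : MvPolynomial (Fin n) ℝ) :
    sphereEval n P ∈ ⨆ k, sphericalHarmonics n k := by
  rw [← sum_homogeneousComponent P, map_sum]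
  refine Submodule.sum_mem _ fun d _ => ?_
  have h1 := homogeneousComponent_isHomogeneous d P
  have h2 : (homogeneousComponent d P).IsHomogeneous (2 * (d / 2) + d % 2) := by
    rwa [Nat.div_add_mod]
  refine sphereEval_mem_iSup_of_pow_eq_zero (d / 2) h2 ?_
  rw [pow_succ', Module.End.mul_apply]
  exact polyLaplacian_eq_zero_of_isHomogeneous (isHomogeneous_polyLaplacianₗ_pow _ h2) (by omega)

theorem dense_range_sphereEval : Dense (Set.range (sphereEval n)) := by
  have h := ContinuousMap.subalgebra_topologicalClosure_eq_top_of_separatesPoints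
    (sphereEval n).range (fun x y hxy => by
      by_contra! hcon
      refine hxy (Subtype.ext (PiLp.ext fun i => ?_))
      have := hcon (sphereEval n (X i)) ⟨sphereEval n (X i), ⟨X i, rfl⟩, rfl⟩
      simpa [sphereEval_apply] using this)
  have h2 := congrArg (fun S : Subalgebra ℝ _ => (S : Set C(sphere (0 : EuclideanSpace ℝ (Fin n)) 1, ℝ))) h
  simpa [Subalgebra.topologicalClosure_coe, dense_iff_closure_eq] using h2

end Decomposition

section Equator
open MvPolynomial

variable {n N : ℕ}

/-- The polynomial `P ∘ e` for a linear isometry `e`. -/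
noncomputable def pullbackPoly (e : EuclideanSpace ℝ (Fin N) →ₗᵢ[ℝ] EuclideanSpace ℝ (Fin n)) :
    MvPolynomial (Fin n) ℝ →ₐ[ℝ] MvPolynomial (Fin N) ℝ :=
  aeval fun i => ∑ j, C (e (EuclideanSpace.single j 1) i) * X j

/-- The directional derivative of a polynomial. -/
noncomputable def dirDeriv (y : Fin n → ℝ) (P : MvPolynomial (Fin n) ℝ) : MvPolynomial (Fin n) ℝ :=
  ∑ i, y i • pderiv i P

variable (e : EuclideanSpace ℝ (Fin N) →ₗᵢ[ℝ] EuclideanSpace ℝ (Fin n))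

theorem isometry_apply_eq_sum (x : EuclideanSpace ℝ (Fin N)) (i : Fin n) :
    e x i = ∑ j, e (EuclideanSpace.single j 1) i * x j := by
  conv_lhs => rw [← (EuclideanSpace.basisFun (Fin N) ℝ).sum_repr x]
  simp [mul_comm]

theorem eval_pullbackPoly (P : MvPolynomial (Fin n) ℝ) (x : EuclideanSpace ℝ (Fin N)) :
    eval x.ofLp (pullbackPoly e P) = eval (e x).ofLp P := by
  induction P using MvPolynomial.induction_on with
  | C a => simp [pullbackPoly]
  | add P Q hP hQ => simp [hP, hQ]
  | mul_X P j hP =>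
    rw [map_mul, map_mul, hP, map_mul, eval_X, isometry_apply_eq_sum]
    simp [pullbackPoly]

theorem sphereEval_pullbackPoly (P : MvPolynomial (Fin n) ℝ)
    (ω : sphere (0 : EuclideanSpace ℝ (Fin N)) 1) :
    sphereEval N (pullbackPoly e P) ω = sphereEval n P (sphereMap e ω) := by
  rw [sphereEval_apply, sphereEval_apply, eval_pullbackPoly]
  rfl

theorem isHomogeneous_pullbackPoly {P : MvPolynomial (Fin n) ℝ} {d : ℕ} (hP : P.IsHomogeneous d) :
    (pullbackPoly e P).IsHomogeneous d := by
  have := hP.aeval (fun i => ∑ j, C (e (EuclideanSpace.single j 1) i) * X j) (n := 1) fun i =>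
    IsHomogeneous.sum _ _ _ fun j _ => (isHomogeneous_X ℝ j).C_mul _
  rwa [one_mul] at this

theorem pderiv_pullbackPoly (P : MvPolynomial (Fin n) ℝ) (j : Fin N) :
    pderiv j (pullbackPoly e P)
      = ∑ i, e (EuclideanSpace.single j 1) i • pullbackPoly e (pderiv i P) := by
  induction P using MvPolynomial.induction_on with
  | C a => simp [pullbackPoly]
  | add P Q hP hQ => simp [hP, hQ, Finset.sum_add_distrib]
  | mul_X P k hP =>
    have hX : pderiv j (pullbackPoly e (X k)) = C (e (EuclideanSpace.single j 1) k) := by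
      simp only [pullbackPoly, aeval_X, map_sum, Derivation.leibniz, pderiv_C, add_zero,
        pderiv_X, smul_eq_mul, Pi.single_apply, mul_ite, mul_one, mul_zero]
      simp
    have h2 : ∀ i, pderiv (R := ℝ) i (P * X k) = P * C (if i = k then 1 else 0)
        + X k * pderiv i P := by
      intro i
      rw [Derivation.leibniz, smul_eq_mul, smul_eq_mul]
      by_cases h : i = k
      · simp [h]
      · rw [pderiv_X_of_ne (Ne.symm h)]
        simp [h]
    simp only [h2, map_mul, Derivation.leibniz, hX, hP, map_add, smul_add, Finset.sum_add_distrib,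
      smul_eq_mul]
    congr 1
    · rw [Finset.sum_eq_single k]
      · simp [smul_eq_C_mul, mul_comm]
      · intro i _ hi; simp [hi]
      · simp
    · rw [Finset.mul_sum]
      exact Finset.sum_congr rfl fun i _ => mul_smul_comm _ _ _

theorem sum_isometry_single_mul {y : EuclideanSpace ℝ (Fin n)} (hy : ‖y‖ = 1)
    (he : LinearMap.range e.toLinearMap = (Submodule.span ℝ {y})ᗮ) (i i' : Fin n) :
    ∑ j, e (EuclideanSpace.single j 1) i * e (EuclideanSpace.single j 1) i'
      = (if i = i' then 1 else 0) - y i * y i' := by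
  have hex : ∀ i : Fin n, ∃ w, e w = EuclideanSpace.single i 1 - y i • y := by
    intro i
    have : EuclideanSpace.single i 1 - y i • y ∈ LinearMap.range e.toLinearMap := by
      rw [he, Submodule.mem_orthogonal_singleton_iff_inner_right, inner_sub_right,
        inner_smul_right, real_inner_self_eq_norm_sq, hy, EuclideanSpace.inner_single_right]
      simp
    exact this
  have horth : ∀ x, inner ℝ y (e x) = 0 := by
    intro x
    have : e x ∈ LinearMap.range e.toLinearMap := ⟨x, rfl⟩
    rwa [he, Submodule.mem_orthogonal_singleton_iff_inner_right] at this
  have hcoord : ∀ (i : Fin n) w, e w = EuclideanSpace.single i 1 - y i • y → ∀ j,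
      e (EuclideanSpace.single j 1) i = w j := by
    intro i w hw j
    have h1 : inner ℝ (e w) (e (EuclideanSpace.single j 1)) = w j := by
      rw [e.inner_map_map, EuclideanSpace.inner_single_right]
      simp
    rw [← h1, hw, inner_sub_left, inner_smul_left, horth, EuclideanSpace.inner_single_left]
    simp
  obtain ⟨w, hw⟩ := hex i
  obtain ⟨w', hw'⟩ := hex i'
  simp only [hcoord i w hw, hcoord i' w' hw']
  have h2 : ∑ j, w j * w' j = inner ℝ (e w) (e w') := by
    rw [e.inner_map_map, PiLp.inner_apply]
    simp [mul_comm]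
  rw [h2, hw, hw', inner_sub_left, inner_sub_right, inner_sub_right]
  simp only [inner_smul_left, inner_smul_right, real_inner_self_eq_norm_sq, hy,
    EuclideanSpace.inner_single_left, EuclideanSpace.inner_single_right]
  simp [eq_comm, mul_comm]

theorem isHomogeneous_dirDeriv (y : Fin n → ℝ) {P : MvPolynomial (Fin n) ℝ} {d : ℕ}
    (hP : P.IsHomogeneous d) : (dirDeriv y P).IsHomogeneous (d - 1) :=
  IsHomogeneous.sum _ _ _ fun i _ => by
    rw [smul_eq_C_mul]
    exact hP.pderiv.C_mul _

theorem IsSolidHarmonic.dirDeriv (y : Fin n → ℝ) {P : MvPolynomial (Fin n) ℝ} {k : ℕ}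
    (hP : IsSolidHarmonic k P) : IsSolidHarmonic (k - 1) (dirDeriv y P) := by
  refine ⟨isHomogeneous_dirDeriv y hP.isHomogeneous, ?_⟩
  rw [_root_.dirDeriv, polyLaplacian_sum]
  simp [polyLaplacian_smul, (hP.pderiv _).polyLaplacian_eq_zero]

theorem eval_dirDeriv_self (y : Fin n → ℝ) {P : MvPolynomial (Fin n) ℝ} {d : ℕ}
    (hP : P.IsHomogeneous d) : eval y (dirDeriv y P) = d * eval y P := by
  have := congrArg (eval y) hP.sum_X_mul_pderiv
  simpa [dirDeriv] using this

theorem polyLaplacian_pullbackPoly {y : EuclideanSpace ℝ (Fin n)} (hy : ‖y‖ = 1)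
    (he : LinearMap.range e.toLinearMap = (Submodule.span ℝ {y})ᗮ) (P : MvPolynomial (Fin n) ℝ) :
    polyLaplacian (pullbackPoly e P)
      = pullbackPoly e (polyLaplacian P) - pullbackPoly e (dirDeriv y (dirDeriv y P)) := by
  have h1 : polyLaplacian (pullbackPoly e P) = ∑ i, ∑ i',
      ((if i = i' then 1 else 0) - y i * y i') • pullbackPoly e (pderiv i' (pderiv i P)) := by
    simp only [← sum_isometry_single_mul e hy he, Finset.sum_smul]
    rw [polyLaplacian]
    simp only [pderiv_pullbackPoly, map_sum, Derivation.map_smul, Finset.smul_sum, smul_smul]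
    rw [Finset.sum_comm]
    exact Finset.sum_congr rfl fun i _ => Finset.sum_comm
  rw [h1]
  simp only [sub_smul, Finset.sum_sub_distrib, polyLaplacian, dirDeriv, map_sum, map_smul,
    Derivation.map_smul, Finset.smul_sum, smul_smul]
  refine congrArg₂ (· - ·) (Finset.sum_congr rfl fun i _ => ?_) ?_
  · simp
  · refine Finset.sum_congr rfl fun i _ => Finset.sum_congr rfl fun j _ => ?_
    rw [pderiv_pderiv_comm]

/-- The eigenvalue of averaging over equators of `S^N` on spherical harmonics of degree `k`. -/
noncomputable def radonEigenvalue (N : ℕ) : ℕ → ℝ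
  | 0 => 1
  | 1 => 0
  | k + 2 => -((k + 1) / (k + N)) * radonEigenvalue N k

theorem sphereMean_pullbackPoly [NeZero N] (hN : 2 ≤ N) {y : EuclideanSpace ℝ (Fin n)}
    (hy : ‖y‖ = 1) (he : LinearMap.range e.toLinearMap = (Submodule.span ℝ {y})ᗮ) (k : ℕ)
    {P : MvPolynomial (Fin n) ℝ} (hP : IsSolidHarmonic k P) :
    sphereMean N (pullbackPoly e P) = radonEigenvalue N k * eval y.ofLp P := by
  have hN' : (2 : ℝ) ≤ N := by exact_mod_cast hN
  induction k using Nat.twoStepInduction generalizing P with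
  | zero =>
    rw [eq_C_of_isHomogeneous_zero hP.isHomogeneous, pullbackPoly, aeval_C, algebraMap_eq,
      sphereMean_C, eval_C, radonEigenvalue, one_mul]
  | one =>
    have h := sphereMean_polyLaplacian (isHomogeneous_pullbackPoly e hP.isHomogeneous)
    rw [polyLaplacian_eq_zero_of_isHomogeneous (isHomogeneous_pullbackPoly e hP.isHomogeneous)
      le_rfl, map_zero] at h
    rw [radonEigenvalue, zero_mul]
    refine (mul_eq_zero.mp h.symm).resolve_left ?_
    have : (0 : ℝ) < 1 * (1 + N - 2) := by linarith
    simpa using this.ne'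
  | more k ih _ =>
    have h := sphereMean_polyLaplacian (isHomogeneous_pullbackPoly e hP.isHomogeneous)
    rw [polyLaplacian_pullbackPoly e hy he, hP.polyLaplacian_eq_zero, map_zero, zero_sub, map_neg,
      ih ((hP.dirDeriv _).dirDeriv _), eval_dirDeriv_self _ (hP.dirDeriv _).isHomogeneous,
      eval_dirDeriv_self _ hP.isHomogeneous] at h
    rw [radonEigenvalue]
    push_cast [Nat.add_sub_cancel, show k + 2 - 1 = k + 1 from rfl] at h
    have hk : (0 : ℝ) ≤ k := k.cast_nonneg
    have h1 : (k : ℝ) + N ≠ 0 := by positivity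
    have h2 : (k : ℝ) + 2 ≠ 0 := by positivity
    field_simp
    apply mul_left_cancel₀ h2
    linear_combination -h

theorem exists_isometry_range_eq {n : ℕ} {y : EuclideanSpace ℝ (Fin n)} (hy : ‖y‖ = 1) :
    ∃ e : EuclideanSpace ℝ (Fin (n - 1)) →ₗᵢ[ℝ] EuclideanSpace ℝ (Fin n),
      LinearMap.range e.toLinearMap = (Submodule.span ℝ {y})ᗮ := by
  have hy0 : y ≠ 0 := by
    rintro rfl
    simp at hy
  have hfin : Module.finrank ℝ (Submodule.span ℝ {y})ᗮ = n - 1 := by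
    have h1 := (Submodule.span ℝ {y}).finrank_add_finrank_orthogonal
    rw [finrank_span_singleton hy0, finrank_euclideanSpace_fin] at h1
    omega
  let b := (stdOrthonormalBasis ℝ (Submodule.span ℝ {y})ᗮ).reindex (finCongr hfin)
  refine ⟨(Submodule.span ℝ {y})ᗮ.subtypeₗᵢ.comp b.repr.symm.toLinearIsometry, ?_⟩
  ext x
  constructor
  · rintro ⟨w, rfl⟩
    exact (b.repr.symm w).2
  · intro hx
    exact ⟨b.repr ⟨x, hx⟩, by simp⟩

end Equator

section RadonMultiplier
open MvPolynomial Filter Topology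

variable {n : ℕ}

/-- `f` is a bounded measurable function whose averages `y ↦ ∫ f dκ_y` are measurable and act on
spherical harmonics of degree `k` as multiplication by `μ k`. -/
structure IsRadonMultiplier
    (κ : sphere (0 : EuclideanSpace ℝ (Fin n)) 1 → Measure (sphere (0 : EuclideanSpace ℝ (Fin n)) 1))
    (μ : ℕ → ℝ) (f : sphere (0 : EuclideanSpace ℝ (Fin n)) 1 → ℝ) : Prop where
  measurable : Measurable f
  bounded : ∃ c, ∀ x, |f x| ≤ c
  measurable_integral : Measurable fun y => ∫ x, f x ∂κ y
  integral_mul : ∀ k P, IsSolidHarmonic k P →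
    ∫ y, (∫ x, f x ∂κ y) * sphereEval n P y ∂uSphere n
      = μ k * ∫ x, f x * sphereEval n P x ∂uSphere n

variable {κ : sphere (0 : EuclideanSpace ℝ (Fin n)) 1 →
    Measure (sphere (0 : EuclideanSpace ℝ (Fin n)) 1)}
  {μ : ℕ → ℝ} {f g : sphere (0 : EuclideanSpace ℝ (Fin n)) 1 → ℝ}

theorem integrable_of_abs_le {Ω : Type*} [MeasurableSpace Ω] {ν : Measure Ω} [IsFiniteMeasure ν]
    {f : Ω → ℝ} (hf : Measurable f) {c : ℝ} (hc : ∀ x, |f x| ≤ c) : Integrable f ν :=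
  Integrable.of_bound hf.aestronglyMeasurable c (.of_forall fun x => hc x)

theorem abs_integral_le_of_abs_le {Ω : Type*} [MeasurableSpace Ω] {ν : Measure Ω}
    [IsProbabilityMeasure ν] {f : Ω → ℝ} {c : ℝ} (hc : ∀ x, |f x| ≤ c) : |∫ x, f x ∂ν| ≤ c := by
  simpa using norm_integral_le_of_norm_le_const (μ := ν) (f := f) (.of_forall fun x => hc x)

theorem IsRadonMultiplier.const_mul (hf : IsRadonMultiplier κ μ f) (a : ℝ) :
    IsRadonMultiplier κ μ fun x => a * f x := by
  obtain ⟨c, hc⟩ := hf.bounded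
  refine ⟨hf.measurable.const_mul a, ⟨|a| * c, fun x => ?_⟩, ?_, fun k P hP => ?_⟩
  · rw [abs_mul]
    exact mul_le_mul_of_nonneg_left (hc x) (abs_nonneg a)
  · simp only [integral_const_mul]
    exact hf.measurable_integral.const_mul a
  · simp only [integral_const_mul, mul_assoc]
    rw [hf.integral_mul k P hP]
    ring

variable [NeZero n]

theorem IsRadonMultiplier.of_isSolidHarmonic (hn : 2 ≤ n)
    (hκ : ∀ k P, IsSolidHarmonic k P → ∀ y, ∫ x, sphereEval n P x ∂κ y = μ k * sphereEval n P y)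
    {k : ℕ} {P : MvPolynomial (Fin n) ℝ} (hP : IsSolidHarmonic k P) :
    IsRadonMultiplier κ μ (sphereEval n P) := by
  refine ⟨(sphereEval n P).continuous.measurable, ⟨_, (sphereEval n P).norm_coe_le_norm⟩, ?_,
    fun l Q hQ => ?_⟩
  · simp only [hκ k P hP]
    exact (sphereEval n P).continuous.measurable.const_mul _
  · simp only [hκ k P hP, mul_assoc, integral_const_mul]
    rcases eq_or_ne k l with rfl | hkl
    · rfl
    · have := sphereMean_mul_eq_zero hn hkl hP hQ
      simp only [sphereMean_apply, map_mul, ContinuousMap.mul_apply] at this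
      rw [this, mul_zero, mul_zero]

theorem integrable_mul_continuousMap (hf : Measurable f) {c : ℝ} (hc : ∀ x, |f x| ≤ c)
    (p : C(sphere (0 : EuclideanSpace ℝ (Fin n)) 1, ℝ)) :
    Integrable (fun x => f x * p x) (uSphere n) :=
  (integrable_continuousMap_uSphere p).bdd_mul hf.aestronglyMeasurable
    (.of_forall fun x => hc x)

namespace IsRadonMultiplier

variable [∀ y, IsProbabilityMeasure (κ y)]

theorem add (hf : IsRadonMultiplier κ μ f) (hg : IsRadonMultiplier κ μ g) :
    IsRadonMultiplier κ μ fun x => f x + g x := by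
  obtain ⟨c, hc⟩ := hf.bounded
  obtain ⟨d, hd⟩ := hg.bounded
  have h : ∀ y, ∫ x, (f x + g x) ∂κ y = (∫ x, f x ∂κ y) + ∫ x, g x ∂κ y := fun y =>
    integral_add (integrable_of_abs_le hf.measurable hc) (integrable_of_abs_le hg.measurable hd)
  refine ⟨hf.measurable.add hg.measurable,
    ⟨c + d, fun x => (abs_add_le _ _).trans (add_le_add (hc x) (hd x))⟩, ?_, fun k P hP => ?_⟩
  · simp only [h]
    exact hf.measurable_integral.add hg.measurable_integral
  · simp only [h, add_mul]
    rw [integral_add (integrable_mul_continuousMap hf.measurable_integral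
        (fun y => abs_integral_le_of_abs_le hc) _)
      (integrable_mul_continuousMap hg.measurable_integral
        (fun y => abs_integral_le_of_abs_le hd) _),
      integral_add (integrable_mul_continuousMap hf.measurable hc _)
        (integrable_mul_continuousMap hg.measurable hd _),
      hf.integral_mul k P hP, hg.integral_mul k P hP, mul_add]

theorem of_tendsto {F : ℕ → sphere (0 : EuclideanSpace ℝ (Fin n)) 1 → ℝ}
    (hF : ∀ i, IsRadonMultiplier κ μ (F i)) {c : ℝ} (hc : ∀ i x, |F i x| ≤ c)
    (hlim : ∀ x, Tendsto (fun i => F i x) atTop (𝓝 (f x))) : IsRadonMultiplier κ μ f := by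
  have hmf : Measurable f :=
    measurable_of_tendsto_metrizable (fun i => (hF i).measurable) (tendsto_pi_nhds.mpr hlim)
  have hcf : ∀ x, |f x| ≤ c := fun x =>
    le_of_tendsto (hlim x).abs (.of_forall fun i => hc i x)
  have hInt : ∀ y, Tendsto (fun i => ∫ x, F i x ∂κ y) atTop (𝓝 (∫ x, f x ∂κ y)) := fun y =>
    tendsto_integral_of_dominated_convergence (fun _ => c)
      (fun i => (hF i).measurable.aestronglyMeasurable) (integrable_const _)
      (fun i => .of_forall (hc i)) (.of_forall hlim)
  refine ⟨hmf, ⟨c, hcf⟩, measurable_of_tendsto_metrizable (fun i => (hF i).measurable_integral)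
    (tendsto_pi_nhds.mpr hInt), fun k P hP => ?_⟩
  have h0 : ∀ {x : ℝ}, |x| ≤ c → ∀ p : ℝ, ‖x * p‖ ≤ c * ‖p‖ := fun hx p => by
    rw [norm_mul]
    exact mul_le_mul_of_nonneg_right hx (norm_nonneg p)
  have hg := (integrable_continuousMap_uSphere (sphereEval n P)).norm.const_mul c
  have h1 := tendsto_integral_of_dominated_convergence (μ := uSphere n)
    (F := fun i y => (∫ x, F i x ∂κ y) * sphereEval n P y)
    (f := fun y => (∫ x, f x ∂κ y) * sphereEval n P y)
    (fun y => c * ‖sphereEval n P y‖)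
    (fun i => ((hF i).measurable_integral.mul (sphereEval n P).continuous.measurable).aestronglyMeasurable)
    hg (fun i => .of_forall fun y => h0 (abs_integral_le_of_abs_le (hc i)) _)
    (.of_forall fun y => (hInt y).mul_const _)
  have h2 := tendsto_integral_of_dominated_convergence (μ := uSphere n)
    (F := fun i x => F i x * sphereEval n P x) (f := fun x => f x * sphereEval n P x)
    (fun y => c * ‖sphereEval n P y‖)
    (fun i => ((hF i).measurable.mul (sphereEval n P).continuous.measurable).aestronglyMeasurable)
    hg (fun i => .of_forall fun y => h0 (hc i y) _)
    (.of_forall fun y => (hlim y).mul_const _)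
  refine tendsto_nhds_unique h1 ?_
  simp only [fun i => (hF i).integral_mul k P hP]
  exact h2.const_mul _

theorem of_continuousMap (hn : 2 ≤ n)
    (hκ : ∀ k P, IsSolidHarmonic k P → ∀ y, ∫ x, sphereEval n P x ∂κ y = μ k * sphereEval n P y)
    (p : C(sphere (0 : EuclideanSpace ℝ (Fin n)) 1, ℝ)) : IsRadonMultiplier κ μ p := by
  have hpoly : ∀ P, IsRadonMultiplier κ μ (sphereEval n P) := by
    intro P
    refine Submodule.iSup_induction (motive := fun q : C(sphere (0 : EuclideanSpace ℝ (Fin n)) 1, ℝ) =>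
      IsRadonMultiplier κ μ ⇑q) _
      (x := sphereEval n P) (sphereEval_mem_iSup P) (fun k q hq => ?_) ?_ fun q r hq hr => hq.add hr
    · obtain ⟨Q, hQ, rfl⟩ := mem_sphericalHarmonics.mp hq
      exact of_isSolidHarmonic hn hκ hQ
    · have := of_isSolidHarmonic (k := 0) (P := 0) hn hκ ⟨isHomogeneous_zero _ _ _, by simp [polyLaplacian]⟩
      simpa using this
  obtain ⟨q, hq, hlim⟩ := mem_closure_iff_seq_limit.mp
    (dense_range_sphereEval.closure_eq ▸ Set.mem_univ p : p ∈ closure (Set.range (sphereEval n)))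
  obtain ⟨c, hc⟩ := (isBounded_range_of_tendsto q hlim).exists_norm_le
  refine of_tendsto (F := fun i => q i) (c := c) (fun i => ?_)
    (fun i x => ((q i).norm_coe_le_norm x).trans (hc _ ⟨i, rfl⟩))
    fun x => ((continuous_eval_const x).tendsto p).comp hlim
  obtain ⟨P, hP⟩ := hq i
  rw [← hP]
  exact hpoly P

theorem of_indicator (hn : 2 ≤ n)
    (hκ : ∀ k P, IsSolidHarmonic k P → ∀ y, ∫ x, sphereEval n P x ∂κ y = μ k * sphereEval n P y)
    {A : Set (sphere (0 : EuclideanSpace ℝ (Fin n)) 1)} (hA : MeasurableSet A) :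
    IsRadonMultiplier κ μ (A.indicator fun _ => 1) := by
  have habs : ∀ (B : Set (sphere (0 : EuclideanSpace ℝ (Fin n)) 1)) x,
      |B.indicator (fun _ => (1 : ℝ)) x| ≤ 1 := fun B x => by
    by_cases hx : x ∈ B <;> simp [hx]
  refine MeasurableSpace.induction_on_inter
    (C := fun B _ => IsRadonMultiplier κ μ (B.indicator fun _ => 1))
    (BorelSpace.measurable_eq.trans borel_eq_generateFrom_isClosed) isPiSystem_isClosed
    ?_ (fun F hF => ?_) (fun B hB ih => ?_) (fun B hd hB ih => ?_) A hA
  · simp only [Set.indicator_empty]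
    exact of_continuousMap hn hκ 0
  · have hF : IsClosed F := hF
    refine of_tendsto (F := fun i x => (hF.apprSeq i x : ℝ)) (c := 1)
      (fun i => of_continuousMap hn hκ ⟨fun x => (hF.apprSeq i x : ℝ), by fun_prop⟩)
      (fun i x => ?_) fun x => ?_
    · rw [abs_of_nonneg (NNReal.coe_nonneg _)]
      exact_mod_cast HasOuterApproxClosed.apprSeq_apply_le_one hF i x
    · have h := tendsto_pi_nhds.mp (HasOuterApproxClosed.tendsto_apprSeq hF) x
      have h2 := (NNReal.continuous_coe.tendsto _).comp h
      have h3 : ((F.indicator (fun _ => 1) x : NNReal) : ℝ) = F.indicator (fun _ => 1) x := by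
        by_cases hx : x ∈ F <;> simp [hx]
      rwa [h3] at h2
  · have h := (of_continuousMap hn hκ 1).add (ih.const_mul (-1))
    convert h using 2 with x
    by_cases hx : x ∈ B <;> simp [hx]
  · have hfin : ∀ s : Finset ℕ, IsRadonMultiplier κ μ ((⋃ i ∈ s, B i).indicator fun _ => 1) := by
      intro s
      induction s using Finset.induction_on with
      | empty =>
        simp only [Finset.notMem_empty, Set.iUnion_of_empty, Set.iUnion_empty, Set.indicator_empty]
        exact of_continuousMap hn hκ 0
      | insert a s has ihs =>
        convert (ih a).add ihs using 2 with x
        rw [Finset.set_biUnion_insert, Set.indicator_union_of_disjoint]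
        rw [Set.disjoint_iUnion₂_right]
        exact fun i hi => hd (by rintro rfl; exact has hi)
    refine of_tendsto (F := fun i => (⋃ j ∈ Finset.range i, B j).indicator fun _ => 1) (c := 1)
      (fun i => hfin _) (fun i x => habs _ x) fun x => ?_
    exact ((tendsto_indicator_biUnion_finset B (fun _ => (1 : ℝ)) x).mono_right (pure_le_nhds _)).comp
      tendsto_finset_range

end IsRadonMultiplier

end RadonMultiplier

section HilbertSum
open scoped InnerProductSpace

/-- Orthogonal components of vectors along a total family of pairwise orthogonal subspaces. -/
theorem exists_orthogonal_components {H : Type*} [NormedAddCommGroup H] [InnerProductSpace ℝ H]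
    [CompleteSpace H] (V : ℕ → Submodule ℝ H)
    (hV : ∀ i j, i ≠ j → ∀ v ∈ V i, ∀ w ∈ V j, ⟪v, w⟫_ℝ = 0)
    (htotal : (⨆ i, V i).topologicalClosure = ⊤) :
    ∃ comp : H → ℕ → H, (∀ v i, comp v i ∈ (V i).topologicalClosure) ∧
      (∀ v i, ∀ u ∈ (V i).topologicalClosure, ⟪comp v i, u⟫_ℝ = ⟪v, u⟫_ℝ) ∧
      ∀ v w, HasSum (fun i => ⟪comp v i, comp w i⟫_ℝ) ⟪v, w⟫_ℝ := by
  classical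
  let W : ℕ → Submodule ℝ H := fun i => (V i).topologicalClosure
  have hW : OrthogonalFamily ℝ (fun i => W i) fun i => (W i).subtypeₗᵢ := by
    refine OrthogonalFamily.of_pairwise fun i j hij => ?_
    have h : V i ≤ (V j)ᗮ := fun v hv =>
      (Submodule.mem_orthogonal _ _).2 fun w hw => hV j i hij.symm w hw v hv
    have h' : W i ≤ (V j)ᗮ :=
      Submodule.topologicalClosure_minimal _ h (Submodule.isClosed_orthogonal _)
    change W i ≤ (W j)ᗮ
    exact h'.trans_eq (Submodule.orthogonal_closure _).symm
  have hle : (⨆ i, V i) ≤ ⨆ i, W i := iSup_mono fun i => Submodule.le_topologicalClosure _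
  have : ∀ i, CompleteSpace (W i) := fun i =>
    (Submodule.isClosed_topologicalClosure (V i)).completeSpace_coe
  have hS : IsHilbertSum ℝ (fun i => W i) fun i => (W i).subtypeₗᵢ :=
    IsHilbertSum.mkInternal _ hW (htotal.symm.le.trans (Submodule.topologicalClosure_mono hle))
  let Φ := hS.linearIsometryEquiv
  refine ⟨fun v i => (Φ v i : W i), fun v i => (Φ v i).2, fun v i u hu => ?_, fun v w => ?_⟩
  · have h := hS.linearIsometryEquiv_symm_apply_single (⟨u, hu⟩ : W i)
    have h2 : ⟪v, u⟫_ℝ = ⟪Φ v, lp.single 2 i (⟨u, hu⟩ : W i)⟫_ℝ := by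
      rw [← Φ.symm.inner_map_map, Φ.symm_apply_apply, h]
      rfl
    rw [h2, lp.inner_single_right]
    rfl
  · have := lp.hasSum_inner (𝕜 := ℝ) (Φ v) (Φ w)
    rw [Φ.inner_map_map] at this
    exact this

end HilbertSum

section HarmonicExpansion
open MvPolynomial
open scoped InnerProductSpace

variable {n : ℕ}

/-- Jensen's inequality on a subset of a probability space. -/
theorem setIntegral_pow_even_le {Ω : Type*} [MeasurableSpace Ω] {ν : Measure Ω}
    [IsProbabilityMeasure ν] (A : Set Ω) {f : Ω → ℝ} (q : ℕ) (hf : Integrable f ν)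
    (hfq : Integrable (fun x => f x ^ (2 * (q + 1))) ν) :
    (∫ x in A, f x ∂ν) ^ (2 * (q + 1)) ≤ ν.real A ^ (2 * q + 1) * ∫ x, f x ^ (2 * (q + 1)) ∂ν := by
  have hev : Even (2 * (q + 1)) := even_two_mul _
  have hnn : 0 ≤ ∫ x, f x ^ (2 * (q + 1)) ∂ν := integral_nonneg fun x => hev.pow_nonneg _
  rcases eq_or_ne (ν A) 0 with h0 | h0
  · rw [setIntegral_measure_zero _ h0, zero_pow (by omega)]
    positivity
  have hα : 0 < ν.real A := ENNReal.toReal_pos h0 (measure_ne_top _ _)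
  have hJ := ConvexOn.map_set_average_le (g := fun x : ℝ => x ^ (2 * (q + 1)))
    hev.convexOn_pow (continuous_pow _).continuousOn isClosed_univ h0 (measure_ne_top ν A)
    (.of_forall fun x => Set.mem_univ (f x)) hf.integrableOn hfq.integrableOn
  rw [setAverage_eq, setAverage_eq, smul_eq_mul, smul_eq_mul, mul_pow] at hJ
  have hle : ∫ x in A, f x ^ (2 * (q + 1)) ∂ν ≤ ∫ x, f x ^ (2 * (q + 1)) ∂ν :=
    setIntegral_le_integral hfq (.of_forall fun x => hev.pow_nonneg _)
  calc (∫ x in A, f x ∂ν) ^ (2 * (q + 1))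
      = ν.real A ^ (2 * (q + 1)) *
          ((ν.real A)⁻¹ ^ (2 * (q + 1)) * (∫ x in A, f x ∂ν) ^ (2 * (q + 1))) := by
        rw [← mul_assoc, ← mul_pow, mul_inv_cancel₀ hα.ne', one_pow, one_mul]
    _ ≤ ν.real A ^ (2 * (q + 1)) * ((ν.real A)⁻¹ * ∫ x in A, f x ^ (2 * (q + 1)) ∂ν) := by
        gcongr
    _ = ν.real A ^ (2 * q + 1) * ∫ x in A, f x ^ (2 * (q + 1)) ∂ν := by
        rw [show 2 * (q + 1) = 2 * q + 1 + 1 by ring, pow_succ, mul_assoc,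
          mul_inv_cancel_left₀ hα.ne']
    _ ≤ _ := by gcongr

variable [NeZero n]

theorem setIntegral_sphereEval_pow_le (hn : 2 ≤ n) {k : ℕ} {P : MvPolynomial (Fin n) ℝ}
    (hP : IsSolidHarmonic k P) (A : Set (sphere (0 : EuclideanSpace ℝ (Fin n)) 1)) (q : ℕ) :
    (∫ x in A, sphereEval n P x ∂uSphere n) ^ (2 * (q + 1)) ≤
      (uSphere n).real A ^ (2 * q + 1) *
        ((2 * q + 1) ^ k * ∫ x, sphereEval n P x * sphereEval n P x ∂uSphere n) ^ (q + 1) := by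
  refine (setIntegral_pow_even_le A q (integrable_continuousMap_uSphere _)
    (integrable_continuousMap_uSphere (sphereEval n P ^ (2 * (q + 1))))).trans ?_
  have h := hypercontractivity hn k q (fun _ : Unit => P) fun _ => hP
  simp only [Finset.univ_unique, Finset.sum_const, Finset.card_singleton, one_smul, sphereMean_apply,
    ← pow_mul, map_pow, ContinuousMap.pow_apply] at h
  simp only [← pow_two]
  exact mul_le_mul_of_nonneg_left h (by positivity)

/-- Spherical harmonics of degree `k` as a subspace of `L²`. -/
noncomputable def sphericalHarmonicsL2 (n : ℕ) [NeZero n] (k : ℕ) : Submodule ℝ (Lp ℝ 2 (uSphere n)) :=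
  (sphericalHarmonics n k).map (ContinuousMap.toLp 2 (uSphere n) ℝ).toLinearMap

theorem mem_sphericalHarmonicsL2 {k : ℕ} {u : Lp ℝ 2 (uSphere n)} :
    u ∈ sphericalHarmonicsL2 n k ↔
      ∃ P, IsSolidHarmonic k P ∧ ContinuousMap.toLp 2 (uSphere n) ℝ (sphereEval n P) = u := by
  simp only [sphericalHarmonicsL2, Submodule.mem_map, mem_sphericalHarmonics]
  constructor
  · rintro ⟨_, ⟨P, hP, rfl⟩, h⟩
    exact ⟨P, hP, h⟩
  · rintro ⟨P, hP, h⟩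
    exact ⟨_, ⟨P, hP, rfl⟩, h⟩

theorem inner_sphericalHarmonicsL2 (hn : 2 ≤ n) {i j : ℕ} (hij : i ≠ j) :
    ∀ v ∈ sphericalHarmonicsL2 n i, ∀ w ∈ sphericalHarmonicsL2 n j, ⟪v, w⟫_ℝ = 0 := by
  intro v hv w hw
  obtain ⟨P, hP, rfl⟩ := mem_sphericalHarmonicsL2.mp hv
  obtain ⟨Q, hQ, rfl⟩ := mem_sphericalHarmonicsL2.mp hw
  rw [ContinuousMap.inner_toLp]
  simpa [sphereMean_apply] using sphereMean_mul_eq_zero hn hij.symm hQ hP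

theorem topologicalClosure_iSup_sphericalHarmonicsL2 :
    (⨆ k, sphericalHarmonicsL2 n k).topologicalClosure = ⊤ := by
  have hd : Dense (ContinuousMap.toLp 2 (uSphere n) ℝ '' Set.range (sphereEval n)) :=
    (ContinuousMap.toLp_denseRange ℝ (uSphere n) (p := 2) ℝ ENNReal.ofNat_ne_top).dense_image
      (ContinuousMap.toLp 2 (uSphere n) ℝ).continuous dense_range_sphereEval
  rw [← Submodule.dense_iff_topologicalClosure_eq_top]
  refine hd.mono ?_
  rintro _ ⟨_, ⟨P, rfl⟩, rfl⟩
  have := Submodule.mem_map_of_mem (f := (ContinuousMap.toLp 2 (uSphere n) ℝ).toLinearMap)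
    (sphereEval_mem_iSup P)
  rwa [Submodule.map_iSup] at this

theorem inner_indicatorConstLp_toLp {A : Set (sphere (0 : EuclideanSpace ℝ (Fin n)) 1)}
    (hA : MeasurableSet A) (p : C(sphere (0 : EuclideanSpace ℝ (Fin n)) 1, ℝ)) :
    ⟪indicatorConstLp 2 hA (measure_ne_top (uSphere n) A) (1 : ℝ),
      ContinuousMap.toLp 2 (uSphere n) ℝ p⟫_ℝ = ∫ x in A, p x ∂uSphere n := by
  rw [L2.inner_indicatorConstLp_one]
  exact setIntegral_congr_ae hA ((p.coeFn_toLp (p := 2) (𝕜 := ℝ) (uSphere n)).mono fun _ h _ => h)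

theorem eq_inner_one_smul_of_mem_closure {u : Lp ℝ 2 (uSphere n)}
    (hu : u ∈ (sphericalHarmonicsL2 n 0).topologicalClosure) :
    u = ⟪ContinuousMap.toLp 2 (uSphere n) ℝ 1, u⟫_ℝ • ContinuousMap.toLp 2 (uSphere n) ℝ 1 := by
  refine closure_minimal (t := {u : Lp ℝ 2 (uSphere n) |
    u = ⟪ContinuousMap.toLp 2 (uSphere n) ℝ 1, u⟫_ℝ • ContinuousMap.toLp 2 (uSphere n) ℝ 1})
    (fun u hu => ?_) (isClosed_eq continuous_id (by fun_prop)) hu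
  obtain ⟨P, hP, rfl⟩ := mem_sphericalHarmonicsL2.mp hu
  obtain ⟨c, hc⟩ : ∃ c, P = C c := ⟨_, eq_C_of_isHomogeneous_zero hP.isHomogeneous⟩
  have h : sphereEval n P = c • 1 := by
    ext x
    simp [hc]
  rw [Set.mem_ofPred_eq, h, map_smul, inner_smul_right, ContinuousMap.inner_toLp]
  simp

theorem inner_indicatorConstLp_pow_le (hn : 2 ≤ n) {k : ℕ}
    {A : Set (sphere (0 : EuclideanSpace ℝ (Fin n)) 1)} (hA : MeasurableSet A) (q : ℕ)
    {u : Lp ℝ 2 (uSphere n)} (hu : u ∈ (sphericalHarmonicsL2 n k).topologicalClosure) :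
    ⟪indicatorConstLp 2 hA (measure_ne_top (uSphere n) A) (1 : ℝ), u⟫_ℝ ^ (2 * (q + 1)) ≤
      (uSphere n).real A ^ (2 * q + 1) * ((2 * q + 1) ^ k * ⟪u, u⟫_ℝ) ^ (q + 1) := by
  refine closure_minimal (t := {u : Lp ℝ 2 (uSphere n) |
    ⟪indicatorConstLp 2 hA (measure_ne_top (uSphere n) A) (1 : ℝ), u⟫_ℝ ^ (2 * (q + 1)) ≤
      (uSphere n).real A ^ (2 * q + 1) * ((2 * q + 1) ^ k * ⟪u, u⟫_ℝ) ^ (q + 1)})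
    (fun u hu => ?_) (isClosed_le (by fun_prop) (by fun_prop)) hu
  obtain ⟨P, hP, rfl⟩ := mem_sphericalHarmonicsL2.mp hu
  rw [Set.mem_ofPred_eq, inner_indicatorConstLp_toLp, ContinuousMap.inner_toLp]
  exact setIntegral_sphereEval_pow_le hn hP A q

/-- The expansion into spherical harmonics of the bilinear form `(A, B) ↦ ∫_B κ_y(A) dσ(y)`, with
the level inequalities for indicator functions. -/
theorem exists_harmonic_expansion (hn : 2 ≤ n)
    {κ : sphere (0 : EuclideanSpace ℝ (Fin n)) 1 →
      Measure (sphere (0 : EuclideanSpace ℝ (Fin n)) 1)} {μ : ℕ → ℝ}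
    [∀ y, IsProbabilityMeasure (κ y)]
    (hκ : ∀ k P, IsSolidHarmonic k P → ∀ y, ∫ x, sphereEval n P x ∂κ y = μ k * sphereEval n P y)
    {A B : Set (sphere (0 : EuclideanSpace ℝ (Fin n)) 1)} (hA : MeasurableSet A)
    (hB : MeasurableSet B) :
    (Measurable fun y => (κ y).real A) ∧
    ∃ a b c : ℕ → ℝ, (∀ k, 0 ≤ a k) ∧ (∀ k, 0 ≤ b k) ∧ (∀ k, |c k| ≤ a k * b k) ∧
      c 0 = (uSphere n).real A * (uSphere n).real B ∧
      HasSum (fun k => μ k * c k) (∫ y in B, (κ y).real A ∂uSphere n) ∧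
      HasSum (fun k => a k ^ 2) ((uSphere n).real A) ∧
      HasSum (fun k => b k ^ 2) ((uSphere n).real B) ∧
      (∀ k q : ℕ, (a k ^ 2) ^ (q + 1) ≤
        (uSphere n).real A ^ (2 * q + 1) * ((2 * q + 1) ^ k) ^ (q + 1)) ∧
      ∀ k q : ℕ, (b k ^ 2) ^ (q + 1) ≤
        (uSphere n).real B ^ (2 * q + 1) * ((2 * q + 1) ^ k) ^ (q + 1) := by
  have hR := IsRadonMultiplier.of_indicator hn hκ hA
  have hInt : ∀ y, ∫ x, A.indicator (fun _ => (1 : ℝ)) x ∂κ y = (κ y).real A := fun y => by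
    rw [integral_indicator_const _ hA, smul_eq_mul, mul_one]
  have hmeas : Measurable fun y => (κ y).real A := by
    simpa only [hInt] using hR.measurable_integral
  refine ⟨hmeas, ?_⟩
  obtain ⟨comp, hmem, hcomp, hsum⟩ := exists_orthogonal_components (sphericalHarmonicsL2 n)
    (fun i j => inner_sphericalHarmonicsL2 hn) topologicalClosure_iSup_sphericalHarmonicsL2
  set T := ContinuousMap.toLp (E := ℝ) 2 (uSphere n) ℝ
  set vA := indicatorConstLp 2 hA (measure_ne_top (uSphere n) A) (1 : ℝ) with hvA
  set vB := indicatorConstLp 2 hB (measure_ne_top (uSphere n) B) (1 : ℝ) with hvB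
  have hM : MemLp (fun y => (κ y).real A) 2 (uSphere n) :=
    MemLp.of_bound hmeas.aestronglyMeasurable 1 (.of_forall fun y => by
      rw [Real.norm_of_nonneg measureReal_nonneg]
      exact measureReal_le_one)
  set vM := hM.toLp _ with hvM
  have hlevel : ∀ (E : Set (sphere (0 : EuclideanSpace ℝ (Fin n)) 1)) (hE : MeasurableSet E)
      (k q : ℕ),
      (‖comp (indicatorConstLp 2 hE (measure_ne_top (uSphere n) E) (1 : ℝ)) k‖ ^ 2) ^ (q + 1) ≤
        (uSphere n).real E ^ (2 * q + 1) * ((2 * q + 1) ^ k) ^ (q + 1) := by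
    intro E hE k q
    have h := inner_indicatorConstLp_pow_le hn hE q
      (hmem (indicatorConstLp 2 hE (measure_ne_top (uSphere n) E) (1 : ℝ)) k)
    rw [← hcomp _ k _ (hmem _ k), real_inner_self_eq_norm_sq] at h
    set X := ‖comp (indicatorConstLp 2 hE (measure_ne_top (uSphere n) E) (1 : ℝ)) k‖ ^ 2
    rcases (show 0 ≤ X by positivity).eq_or_lt with h0 | h0
    · rw [← h0, zero_pow (by omega)]
      positivity
    · have hX : 0 < X ^ (q + 1) := by positivity
      refine le_of_mul_le_mul_right ?_ hX
      calc X ^ (q + 1) * X ^ (q + 1) = X ^ (2 * (q + 1)) := by ring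
        _ ≤ _ := h
        _ = _ := by rw [mul_pow]; ring
  have hself : ∀ (E : Set (sphere (0 : EuclideanSpace ℝ (Fin n)) 1)) (hE : MeasurableSet E),
      HasSum (fun k => ‖comp (indicatorConstLp 2 hE (measure_ne_top (uSphere n) E) (1 : ℝ)) k‖ ^ 2)
        ((uSphere n).real E) := by
    intro E hE
    have h := hsum (indicatorConstLp 2 hE (measure_ne_top (uSphere n) E) (1 : ℝ))
      (indicatorConstLp 2 hE (measure_ne_top (uSphere n) E) (1 : ℝ))
    rw [L2.real_inner_indicatorConstLp_one_indicatorConstLp_one, Set.inter_self] at h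
    simpa only [real_inner_self_eq_norm_sq] using h
  have hone : T 1 ∈ (sphericalHarmonicsL2 n 0).topologicalClosure :=
    Submodule.le_topologicalClosure _ (mem_sphericalHarmonicsL2.mpr
      ⟨1, ⟨isHomogeneous_one _ _, by simp [polyLaplacian]⟩, by rw [map_one]⟩)
  have hinner_one : ∀ (E : Set (sphere (0 : EuclideanSpace ℝ (Fin n)) 1)) (hE : MeasurableSet E),
      ⟪indicatorConstLp 2 hE (measure_ne_top (uSphere n) E) (1 : ℝ), T 1⟫_ℝ
        = (uSphere n).real E := fun E hE => by
    rw [inner_indicatorConstLp_toLp]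
    simp
  have heigen : ∀ k, ∀ u ∈ (sphericalHarmonicsL2 n k).topologicalClosure,
      ⟪vM, u⟫_ℝ = μ k * ⟪vA, u⟫_ℝ := by
    intro k u hu
    refine closure_minimal (t := {u : Lp ℝ 2 (uSphere n) | ⟪vM, u⟫_ℝ = μ k * ⟪vA, u⟫_ℝ})
      (fun u hu => ?_) (isClosed_eq (by fun_prop) (by fun_prop)) hu
    obtain ⟨P, hP, rfl⟩ := mem_sphericalHarmonicsL2.mp hu
    have h := hR.integral_mul k P hP
    simp only [hInt] at h
    rw [Set.mem_ofPred_eq, inner_indicatorConstLp_toLp, ← integral_indicator hA, L2.inner_def]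
    have h1 : ∫ y, ⟪vM y, T (sphereEval n P) y⟫_ℝ ∂uSphere n
        = ∫ y, (κ y).real A * sphereEval n P y ∂uSphere n := by
      refine integral_congr_ae ?_
      filter_upwards [hM.coeFn_toLp,
        (sphereEval n P).coeFn_toLp (p := 2) (𝕜 := ℝ) (uSphere n)] with x h1 h2
      rw [hvM, h1, h2]
      simp [mul_comm]
    rw [h1, h]
    congr 2 with x
    by_cases hx : x ∈ A <;> simp [hx]
  refine ⟨fun k => ‖comp vA k‖, fun k => ‖comp vB k‖, fun k => ⟪comp vA k, comp vB k⟫_ℝ,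
    fun k => norm_nonneg _, fun k => norm_nonneg _, fun k => abs_real_inner_le_norm _ _, ?_, ?_,
    hself A hA, hself B hB, hlevel A hA, hlevel B hB⟩
  · change ⟪comp vA 0, comp vB 0⟫_ℝ = _
    rw [hcomp _ _ _ (hmem vB 0), eq_inner_one_smul_of_mem_closure (hmem vB 0), inner_smul_right,
      hinner_one A hA, real_inner_comm, hcomp _ _ _ hone, hinner_one B hB, mul_comm]
  · have h := hsum vM vB
    have hvMB : ⟪vM, vB⟫_ℝ = ∫ y in B, (κ y).real A ∂uSphere n := by
      rw [real_inner_comm, hvB, L2.inner_indicatorConstLp_one]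
      exact setIntegral_congr_ae hB (hM.coeFn_toLp.mono fun _ h _ => h)
    rw [hvMB] at h
    convert h using 2 with k
    change μ k * ⟪comp vA k, comp vB k⟫_ℝ = _
    rw [hcomp _ _ _ (hmem vB k), hcomp _ _ _ (hmem vB k), heigen k _ (hmem vB k)]

end HarmonicExpansion

section SpectralBounds

theorem radonEigenvalue_odd (N j : ℕ) : radonEigenvalue N (2 * j + 1) = 0 := by
  induction j with
  | zero => rfl
  | succ j ih =>
    rw [show 2 * (j + 1) + 1 = (2 * j + 1) + 2 by ring, radonEigenvalue, ih, mul_zero]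

theorem abs_radonEigenvalue_succ (N j : ℕ) :
    |radonEigenvalue N (2 * (j + 1))|
      = (2 * j + 1) / (2 * j + N) * |radonEigenvalue N (2 * j)| := by
  rw [show 2 * (j + 1) = 2 * j + 2 by ring, radonEigenvalue, abs_mul, abs_neg]
  push_cast
  rw [abs_of_nonneg (by positivity)]

theorem abs_radonEigenvalue_le {N : ℕ} (hN : 1 ≤ N) {j M : ℕ} (hj : j ≤ M) :
    |radonEigenvalue N (2 * j)| ≤ (2 * M / (N + 1)) ^ j := by
  induction j with
  | zero => simp [radonEigenvalue]
  | succ j ih =>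
    rw [abs_radonEigenvalue_succ, pow_succ']
    have hN' : (1 : ℝ) ≤ N := by exact_mod_cast hN
    have hM : (j : ℝ) + 1 ≤ M := by exact_mod_cast hj
    have hj0 : (0 : ℝ) ≤ j := j.cast_nonneg
    refine mul_le_mul ?_ (ih (by omega)) (abs_nonneg _) (by positivity)
    rw [div_le_div_iff₀ (by positivity) (by positivity)]
    nlinarith [mul_nonneg hj0 (sub_nonneg.2 hN'), mul_nonneg hj0 (sub_nonneg.2 hM),
      mul_nonneg (sub_nonneg.2 hM) (by linarith : (0 : ℝ) ≤ N)]

theorem antitone_abs_radonEigenvalue {N : ℕ} (hN : 1 ≤ N) :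
    Antitone fun j => |radonEigenvalue N (2 * j)| := by
  refine antitone_nat_of_succ_le fun j => ?_
  rw [abs_radonEigenvalue_succ]
  have hN' : (1 : ℝ) ≤ N := by exact_mod_cast hN
  refine mul_le_of_le_one_left (abs_nonneg _) ?_
  rw [div_le_one (by positivity)]
  linarith

theorem half_le_log_two_div {α : ℝ} (h0 : 0 < α) (h1 : α ≤ 1) : 1 / 2 ≤ Real.log (2 / α) := by
  have h2 : Real.log 2 ≤ Real.log (2 / α) := by
    refine Real.log_le_log two_pos ?_
    rw [le_div_iff₀ h0]
    linarith
  linarith [Real.log_two_gt_d9]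

/-- The level inequality for even degrees, in terms of `log (2 / α)`. -/
theorem le_of_level_inequality {α x : ℝ} (h0 : 0 < α) (h1 : α ≤ 1) {j : ℕ}
    (hj : 0 < j)
    (h : ∀ q : ℕ, (x ^ 2) ^ (q + 1) ≤ α ^ (2 * q + 1) * ((2 * q + 1) ^ (2 * j)) ^ (q + 1)) :
    x ≤ α * (2 + 4 * Real.log (2 / α) / j) ^ j := by
  have ha := half_le_log_two_div h0 h1
  set a := Real.log (2 / α) with ha_def
  have hj' : (0 : ℝ) < j := by exact_mod_cast hj
  have hpos : 0 < a / j := div_pos (by linarith) hj'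
  obtain ⟨q, hq⟩ : ∃ q, ⌈a / j⌉₊ = q + 1 :=
    Nat.exists_eq_succ_of_ne_zero (Nat.ceil_pos.mpr hpos).ne'
  have hq1 : a ≤ j * (q + 1 : ℕ) := by
    rw [← hq, mul_comm, ← div_le_iff₀ hj']
    exact Nat.le_ceil _
  have hq2 : ((q + 1 : ℕ) : ℝ) < a / j + 1 := by
    rw [← hq]
    exact Nat.ceil_lt_add_one hpos.le
  push_cast at hq2
  have hexp : 1 ≤ α * Real.exp j ^ (q + 1) := by
    rw [← Real.exp_nat_mul, mul_comm _ (j : ℝ)]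
    have : Real.exp a ≤ Real.exp (j * (q + 1 : ℕ)) := Real.exp_le_exp.mpr hq1
    rw [ha_def, Real.exp_log (by positivity), div_le_iff₀ h0] at this
    linarith
  have he : Real.exp j ≤ 4 ^ j := by
    rw [← mul_one (j : ℝ), Real.exp_nat_mul]
    exact pow_le_pow_left₀ (Real.exp_pos _).le (by linarith [Real.exp_one_lt_d9]) _
  have hxsq : x ^ 2 ≤ (α * (2 * (2 * q + 1)) ^ j) ^ 2 := by
    refine le_of_pow_le_pow_left₀ (n := q + 1) (by omega) (by positivity) ?_
    calc (x ^ 2) ^ (q + 1) ≤ α ^ (2 * q + 1) * ((2 * q + 1) ^ (2 * j)) ^ (q + 1) * 1 := by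
          simpa using h q
      _ ≤ α ^ (2 * q + 1) * ((2 * q + 1) ^ (2 * j)) ^ (q + 1) * (α * (4 ^ j) ^ (q + 1)) := by
          have : 1 ≤ α * (4 ^ j) ^ (q + 1) := hexp.trans (by gcongr)
          gcongr
      _ = ((α * (2 * (2 * q + 1)) ^ j) ^ 2) ^ (q + 1) := by
          rw [show (4 : ℝ) ^ j = 2 ^ (2 * j) by rw [pow_mul]; norm_num,
            mul_pow (2 : ℝ) (2 * q + 1) j]
          ring
  refine (le_of_pow_le_pow_left₀ two_ne_zero (by positivity) hxsq).trans ?_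
  gcongr
  rw [mul_div_assoc]
  linarith

theorem low_degree_term_le {N j : ℕ} (hN : 1 ≤ N) (hj : 0 < j) {α β x y : ℝ} (hα : 0 < α)
    (hα1 : α ≤ 1) (hβ : 0 < β) (hβ1 : β ≤ 1) (hx : 0 ≤ x) (hy : 0 ≤ y)
    (hxj : x ≤ α * (2 + 4 * Real.log (2 / α) / j) ^ j)
    (hyj : y ≤ β * (2 + 4 * Real.log (2 / β) / j) ^ j)
    (hjN : 256 * (j : ℝ) ≤ N + 1)
    (hs : 3072 * (Real.log (2 / α) * Real.log (2 / β)) ≤ N + 1) :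
    |radonEigenvalue N (2 * j)| * (x * y) ≤
      α * β * (2048 * (Real.log (2 / α) * Real.log (2 / β)) / (N + 1) * (1 / 2) ^ (2 * j)) := by
  have ha := half_le_log_two_div hα hα1
  have hb := half_le_log_two_div hβ hβ1
  set a := Real.log (2 / α)
  set b := Real.log (2 / β)
  have hj' : (1 : ℝ) ≤ j := by exact_mod_cast hj
  have hab : a + b ≤ 4 * (a * b) := by nlinarith
  have hN0 : (0 : ℝ) < N + 1 := by positivity
  have hbase : 2 * j / (N + 1) * ((2 + 4 * a / j) * (2 + 4 * b / j))
      ≤ (8 * j + 96 * (a * b)) / (N + 1) := by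
    rw [div_mul_eq_mul_div]
    gcongr
    have : 2 * (j : ℝ) * ((2 + 4 * a / j) * (2 + 4 * b / j))
        = 8 * j + 16 * (a + b) + 32 * (a * b) / j := by
      field_simp
      ring
    rw [this]
    have : 32 * (a * b) / j ≤ 32 * (a * b) := div_le_self (by positivity) hj'
    linarith
  set r := (8 * j + 96 * (a * b)) / ((N : ℝ) + 1) with hr
  have hr0 : 0 ≤ r := by positivity
  have hr16 : r ≤ 1 / 16 := by
    rw [hr, div_le_iff₀ hN0]
    linarith
  have hj2 : (j : ℝ) ≤ 2 ^ j := by exact_mod_cast Nat.lt_two_pow_self.le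
  have hrs : r ≤ 128 * (a * b) / (N + 1) * 2 ^ j := by
    rw [hr, div_mul_eq_mul_div]
    gcongr
    have : 1 ≤ 4 * (a * b) := by nlinarith
    nlinarith [mul_le_mul_of_nonneg_left hj2 (by positivity : 0 ≤ a * b)]
  calc |radonEigenvalue N (2 * j)| * (x * y)
      ≤ (2 * j / (N + 1)) ^ j *
          ((α * (2 + 4 * a / j) ^ j) * (β * (2 + 4 * b / j) ^ j)) := by
        gcongr
        exact abs_radonEigenvalue_le hN le_rfl
    _ = α * β * (2 * j / (N + 1) * ((2 + 4 * a / j) * (2 + 4 * b / j))) ^ j := by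
        rw [mul_pow, mul_pow]
        ring
    _ ≤ α * β * r ^ j := by gcongr
    _ = α * β * (r * r ^ (j - 1)) := by rw [← pow_succ', Nat.sub_add_cancel hj]
    _ ≤ α * β * (128 * (a * b) / (N + 1) * 2 ^ j * (1 / 16) ^ (j - 1)) := by gcongr
    _ = α * β * (2048 * (a * b) / (N + 1) * (1 / 8) ^ j) := by
        obtain ⟨i, rfl⟩ : ∃ i, j = i + 1 := ⟨j - 1, by omega⟩
        rw [Nat.add_sub_cancel, show (1 / 8 : ℝ) = 2 * (1 / 16) by norm_num, mul_pow, pow_succ _ i,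
          pow_succ _ i]
        ring
    _ ≤ α * β * (2048 * (a * b) / (N + 1) * (1 / 2) ^ (2 * j)) := by
        have : (0 : ℝ) ≤ a * b := by positivity
        rw [pow_mul]
        gcongr
        norm_num

theorem exp_four_le : Real.exp 4 ≤ 128 := by
  rw [show (4 : ℝ) = (4 : ℕ) * 1 by norm_num, Real.exp_nat_mul]
  exact (pow_le_pow_left₀ (Real.exp_pos _).le
    (by linarith [Real.exp_one_lt_d9] : Real.exp 1 ≤ 3) 4).trans (by norm_num)

theorem high_degree_eigenvalue_le {N j : ℕ} (hN : 1 ≤ N) (hj : (N + 1) / 256 ≤ j) :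
    |radonEigenvalue N (2 * j)| ≤ Real.exp (4 - (N + 1) / 64) := by
  refine (antitone_abs_radonEigenvalue hN hj).trans ?_
  refine (abs_radonEigenvalue_le hN le_rfl).trans ?_
  set J := (N + 1) / 256 with hJ
  have h1 : 256 * J ≤ N + 1 := Nat.mul_div_le _ _
  have h2 : N + 1 < 256 * (J + 1) := by omega
  have h1' : 256 * (J : ℝ) ≤ N + 1 := by exact_mod_cast h1
  have h2' : (N : ℝ) + 1 < 256 * (J + 1) := by exact_mod_cast h2
  calc (2 * J / ((N : ℝ) + 1)) ^ J ≤ Real.exp (-4) ^ J := by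
        gcongr
        rw [Real.exp_neg, div_le_iff₀ (by positivity), inv_mul_eq_div,
          le_div_iff₀ (Real.exp_pos 4)]
        nlinarith [mul_le_mul_of_nonneg_left exp_four_le (by positivity : (0 : ℝ) ≤ 2 * J)]
    _ = Real.exp (-4 * J) := by rw [← Real.exp_nat_mul, mul_comm]
    _ ≤ _ := Real.exp_le_exp.mpr (by linarith)

theorem exp_mul_inv_le {N : ℕ} {α s : ℝ} (hα : 0 < α) (hαs : Real.log (2 / α) ≤ 2 * s)
    (hs : 3072 * s ≤ N + 1) (hs4 : 1 ≤ 4 * s) :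
    Real.exp (4 - (N + 1) / 64) * α⁻¹ ≤ 65536 * s / (N + 1) := by
  have hN0 : (0 : ℝ) < N + 1 := by positivity
  have hinv : α⁻¹ ≤ Real.exp (2 * s) := by
    have h := Real.exp_le_exp.mpr hαs
    rw [Real.exp_log (by positivity)] at h
    refine le_trans ?_ h
    rw [← one_div]
    gcongr
    norm_num
  calc Real.exp (4 - (N + 1) / 64) * α⁻¹
      ≤ Real.exp (4 - (N + 1) / 64) * Real.exp (2 * s) := by gcongr
    _ = Real.exp (4 - (N + 1) / 64 + 2 * s) := (Real.exp_add _ _).symm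
    _ ≤ Real.exp (4 - (N + 1) / 128) := Real.exp_le_exp.mpr (by linarith)
    _ = Real.exp 4 / Real.exp ((N + 1) / 128) := Real.exp_sub _ _
    _ ≤ 128 / ((N + 1) / 128) := by
        gcongr
        · exact exp_four_le
        · linarith [Real.add_one_le_exp (((N : ℝ) + 1) / 128)]
    _ = 16384 / (N + 1) := by
        field_simp
        norm_num
    _ ≤ _ := by
        gcongr
        linarith

theorem abs_div_sub_one_le {N : ℕ} (hN : 1 ≤ N) {α β L : ℝ} (hα : 0 < α) (hα1 : α ≤ 1)
    (hβ : 0 < β) (hβ1 : β ≤ 1) {a b c : ℕ → ℝ} (ha : ∀ k, 0 ≤ a k) (hb : ∀ k, 0 ≤ b k)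
    (hc : ∀ k, |c k| ≤ a k * b k) (hc0 : c 0 = α * β)
    (hL : HasSum (fun k => radonEigenvalue N k * c k) L)
    (haα : HasSum (fun k => a k ^ 2) α) (hbβ : HasSum (fun k => b k ^ 2) β)
    (hla : ∀ k q : ℕ, (a k ^ 2) ^ (q + 1) ≤ α ^ (2 * q + 1) * ((2 * q + 1) ^ k) ^ (q + 1))
    (hlb : ∀ k q : ℕ, (b k ^ 2) ^ (q + 1) ≤ β ^ (2 * q + 1) * ((2 * q + 1) ^ k) ^ (q + 1))
    (hs : 3072 * (Real.log (2 / α) * Real.log (2 / β)) ≤ N + 1) :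
    |L / (α * β) - 1| ≤ 70000 * (Real.log (2 / α) * Real.log (2 / β)) / (N + 1) := by
  have hla2 := half_le_log_two_div hα hα1
  have hlb2 := half_le_log_two_div hβ hβ1
  set s := Real.log (2 / α) * Real.log (2 / β) with hs_def
  have hαs : Real.log (2 / α) ≤ 2 * s := by nlinarith
  have hβs : Real.log (2 / β) ≤ 2 * s := by nlinarith
  have hs4 : 1 ≤ 4 * s := by nlinarith
  set E := Real.exp (4 - ((N : ℝ) + 1) / 64) with hE
  have hE0 : 0 ≤ E := (Real.exp_pos _).le
  have hαβ : 0 < α * β := mul_pos hα hβ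
  have hf : HasSum (fun k => radonEigenvalue N k * c k / (α * β) - if k = 0 then 1 else 0)
      (L / (α * β) - 1) := (hL.div_const _).sub (hasSum_ite_eq 0 1)
  have hF : HasSum (fun k => 2048 * s / (N + 1) * (1 / 2) ^ k +
      E * (1 / 2 * (a k ^ 2 / α ^ 2 + b k ^ 2 / β ^ 2)))
      (2048 * s / (N + 1) * 2 + E * (1 / 2 * (α / α ^ 2 + β / β ^ 2))) :=
    (hasSum_geometric_two.mul_left _).add
      ((((haα.div_const _).add (hbβ.div_const _)).mul_left _).mul_left _)
  have hbound := hf.norm_le_of_bounded hF fun k => ?_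
  · rw [Real.norm_eq_abs] at hbound
    refine hbound.trans ?_
    have h1 := exp_mul_inv_le hα hαs hs hs4
    have h2 := exp_mul_inv_le hβ hβs hs hs4
    have h3 : α / α ^ 2 = α⁻¹ := by field_simp
    have h4 : β / β ^ 2 = β⁻¹ := by field_simp
    have h5 : 0 ≤ s / (N + 1) := by positivity
    rw [h3, h4]
    rw [mul_div_assoc] at h1 h2 ⊢
    rw [mul_div_assoc 70000]
    linarith
  · have hG : 0 ≤ 2048 * s / (N + 1) * (1 / 2) ^ k := by positivity
    have hT : 0 ≤ E * (1 / 2 * (a k ^ 2 / α ^ 2 + b k ^ 2 / β ^ 2)) := by positivity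
    rw [Real.norm_eq_abs]
    rcases Nat.eq_zero_or_pos k with rfl | hk
    · rw [hc0, radonEigenvalue, one_mul, div_self hαβ.ne', if_pos rfl, sub_self, abs_zero]
      exact add_nonneg hG hT
    rw [if_neg hk.ne', sub_zero]
    obtain ⟨j, rfl | rfl⟩ := Nat.even_or_odd' k
    · have hj : 0 < j := by omega
      have habs : |radonEigenvalue N (2 * j) * c (2 * j) / (α * β)| ≤
          |radonEigenvalue N (2 * j)| * (a (2 * j) * b (2 * j)) / (α * β) := by
        rw [abs_div, abs_mul, abs_of_pos hαβ]
        gcongr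
        exact hc _
      refine habs.trans ?_
      rcases le_or_gt (256 * j) (N + 1) with h | h
      · refine le_add_of_le_of_nonneg ?_ hT
        rw [div_le_iff₀' hαβ]
        exact low_degree_term_le hN hj hα hα1 hβ hβ1 (ha _) (hb _)
          (le_of_level_inequality hα hα1 hj (hla _)) (le_of_level_inequality hβ hβ1 hj (hlb _))
          (by exact_mod_cast h) hs
      · refine le_add_of_nonneg_of_le hG ?_
        have hμ : |radonEigenvalue N (2 * j)| ≤ E := high_degree_eigenvalue_le hN (by omega)
        rw [mul_div_assoc, ← div_mul_div_comm]
        refine mul_le_mul hμ ?_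
          (mul_nonneg (div_nonneg (ha _) hα.le) (div_nonneg (hb _) hβ.le)) hE0
        rw [← div_pow, ← div_pow]
        nlinarith [sq_nonneg (a (2 * j) / α - b (2 * j) / β)]
    · rw [radonEigenvalue_odd, zero_mul, zero_div, abs_zero]
      exact add_nonneg hG hT

end SpectralBounds

section EquatorSampling

theorem continuous_sphereMap {m n : ℕ}
    (e : EuclideanSpace ℝ (Fin m) →ₗᵢ[ℝ] EuclideanSpace ℝ (Fin n)) : Continuous (sphereMap e) :=
  (e.continuous.comp continuous_subtype_val).subtype_mk _

/-- Integrals of equator densities over sets of positive measure are close to those of the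
constant function `σ(A)`. -/
theorem abs_setIntegral_equator_div_sub_one_le {n : ℕ} (hn : 3 ≤ n)
    {A : Set (sphere (0 : EuclideanSpace ℝ (Fin n)) 1)} (hA : MeasurableSet A)
    (hα : 0 < (uSphere n).real A) {m : sphere (0 : EuclideanSpace ℝ (Fin n)) 1 → ℝ}
    (hm : ∀ (y : sphere (0 : EuclideanSpace ℝ (Fin n)) 1)
      (e : EuclideanSpace ℝ (Fin (n - 1)) →ₗᵢ[ℝ] EuclideanSpace ℝ (Fin n)),
      LinearMap.range e.toLinearMap = (Submodule.span ℝ {(y : EuclideanSpace ℝ (Fin n))})ᗮ →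
      m y = (uSphere (n - 1) {ω | sphereMap e ω ∈ A}).toReal) :
    Measurable m ∧ (∀ y, |m y| ≤ 1) ∧
      ∀ B, MeasurableSet B → 0 < (uSphere n).real B →
        3072 * (Real.log (2 / (uSphere n).real A) * Real.log (2 / (uSphere n).real B)) ≤ n →
        |(∫ y in B, m y ∂uSphere n) / ((uSphere n).real A * (uSphere n).real B) - 1| ≤
          70000 * (Real.log (2 / (uSphere n).real A) * Real.log (2 / (uSphere n).real B)) / n := by
  obtain ⟨N, rfl⟩ : ∃ N, n = N + 1 := ⟨n - 1, by omega⟩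
  rw [Nat.add_sub_cancel] at hm
  have : NeZero N := ⟨by omega⟩
  have hex : ∀ y : sphere (0 : EuclideanSpace ℝ (Fin (N + 1))) 1,
      ∃ e : EuclideanSpace ℝ (Fin N) →ₗᵢ[ℝ] EuclideanSpace ℝ (Fin (N + 1)),
        LinearMap.range e.toLinearMap
          = (Submodule.span ℝ {(y : EuclideanSpace ℝ (Fin (N + 1)))})ᗮ :=
    fun y => exists_isometry_range_eq (mem_sphere_zero_iff_norm.mp y.2)
  choose e he using hex
  let κ : sphere (0 : EuclideanSpace ℝ (Fin (N + 1))) 1 →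
      Measure (sphere (0 : EuclideanSpace ℝ (Fin (N + 1))) 1) :=
    fun y => (uSphere N).map (sphereMap (e y))
  have hκprob : ∀ y, IsProbabilityMeasure (κ y) := fun y =>
    Measure.isProbabilityMeasure_map (continuous_sphereMap (e y)).aemeasurable
  have hκ : ∀ k P, IsSolidHarmonic k P → ∀ y,
      ∫ x, sphereEval (N + 1) P x ∂κ y = radonEigenvalue N k * sphereEval (N + 1) P y := by
    intro k P hP y
    rw [integral_map (continuous_sphereMap (e y)).aemeasurable
      (sphereEval (N + 1) P).continuous.aestronglyMeasurable]
    have h := sphereMean_pullbackPoly (e y) (by omega) (mem_sphere_zero_iff_norm.mp y.2) (he y) k hP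
    simp only [sphereMean_apply, sphereEval_pullbackPoly] at h
    rw [h, sphereEval_apply]
  have hmκ : m = fun y => (κ y).real A := funext fun y => by
    rw [hm y (e y) (he y), map_measureReal_apply (continuous_sphereMap (e y)).measurable hA]
    rfl
  have hexp := fun {B} => exists_harmonic_expansion (B := B) (by omega) hκ hA
  subst hmκ
  refine ⟨(hexp MeasurableSet.univ).1, fun y => ?_, fun B hB hβ hs => ?_⟩
  · rw [abs_of_nonneg measureReal_nonneg]
    exact measureReal_le_one
  obtain ⟨a, b, c, ha, hb, hc, hc0, hL, haα, hbβ, hla, hlb⟩ := (hexp hB).2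
  push_cast at hs ⊢
  exact abs_div_sub_one_le (by omega) hα measureReal_le_one hβ measureReal_le_one ha hb hc hc0 hL
    haα hbβ hla hlb hs

/-- If the mean `L / β` of a density over a set of measure `β` deviates from `α` by a relative error
`t`, then `β` is exponentially small. -/
theorem measureReal_le_two_mul_exp {n : ℕ} (hn : 3 ≤ n) {α β t L : ℝ} (hα : 0 < α) (hα1 : α ≤ 1)
    (hβ : 0 ≤ β) (ht1 : t < 1)
    (hL : 0 < β → 3072 * (Real.log (2 / α) * Real.log (2 / β)) ≤ n →
      |L / (α * β) - 1| ≤ 70000 * (Real.log (2 / α) * Real.log (2 / β)) / n)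
    (htL : 0 < β → t ≤ |L / (α * β) - 1|) :
    β ≤ 2 * Real.exp (-(1 / 70000 * n * t) / Real.log (2 / α)) := by
  rcases hβ.eq_or_lt with rfl | hβ
  · positivity
  have ha : 0 < Real.log (2 / α) := by linarith [half_le_log_two_div hα hα1]
  have hn0 : (0 : ℝ) < n := by exact_mod_cast (by omega : 0 < n)
  have key : 1 / 70000 * n * t ≤ Real.log (2 / α) * Real.log (2 / β) := by
    rcases le_or_gt (3072 * (Real.log (2 / α) * Real.log (2 / β))) n with h | h
    · have h2 := (htL hβ).trans (hL hβ h)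
      rw [le_div_iff₀ hn0] at h2
      linarith
    · nlinarith
  have h2 : 1 / 70000 * n * t / Real.log (2 / α) ≤ Real.log (2 / β) := by
    rw [div_le_iff₀ ha]
    linarith
  have h3 := Real.exp_le_exp.mpr h2
  rw [Real.exp_log (by positivity), le_div_iff₀ hβ] at h3
  rw [neg_div, Real.exp_neg, ← div_eq_mul_inv, le_div_iff₀ (Real.exp_pos _)]
  linarith

theorem measureReal_abs_div_sub_one_le {n : ℕ} (hn : 3 ≤ n)
    {A : Set (sphere (0 : EuclideanSpace ℝ (Fin n)) 1)} (hA : MeasurableSet A)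
    (hα : 0 < (uSphere n).real A) {m : sphere (0 : EuclideanSpace ℝ (Fin n)) 1 → ℝ}
    (hm : ∀ (y : sphere (0 : EuclideanSpace ℝ (Fin n)) 1)
      (e : EuclideanSpace ℝ (Fin (n - 1)) →ₗᵢ[ℝ] EuclideanSpace ℝ (Fin n)),
      LinearMap.range e.toLinearMap = (Submodule.span ℝ {(y : EuclideanSpace ℝ (Fin n))})ᗮ →
      m y = (uSphere (n - 1) {ω | sphereMap e ω ∈ A}).toReal) {t : ℝ} (ht1 : t < 1) :
    (uSphere n).real {y | t ≤ |m y / (uSphere n).real A - 1|} ≤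
      4 * Real.exp (-(1 / 70000 * n * t) / Real.log (2 / (uSphere n).real A)) := by
  have : NeZero n := ⟨by omega⟩
  obtain ⟨hmeas, hbdd, hL⟩ := abs_setIntegral_equator_div_sub_one_le hn hA hα hm
  have hInt : Integrable m (uSphere n) := integrable_of_abs_le hmeas hbdd
  set α := (uSphere n).real A with hα_def
  have hα1 : α ≤ 1 := measureReal_le_one
  have hB1 : MeasurableSet {y | (1 + t) * α ≤ m y} := measurableSet_le measurable_const hmeas
  have hB2 : MeasurableSet {y | m y ≤ (1 - t) * α} := measurableSet_le hmeas measurable_const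
  have hsub : {y | t ≤ |m y / α - 1|} ⊆ {y | (1 + t) * α ≤ m y} ∪ {y | m y ≤ (1 - t) * α} := by
    intro y hy
    rcases le_abs.mp (show t ≤ |m y / α - 1| from hy) with h | h
    · left
      have h' : 1 + t ≤ m y / α := by linarith
      exact (le_div_iff₀ hα).mp h'
    · right
      have h' : m y / α ≤ 1 - t := by linarith
      exact (div_le_iff₀ hα).mp h'
  have h1 := measureReal_le_two_mul_exp hn hα hα1 measureReal_nonneg ht1
    (hL {y | (1 + t) * α ≤ m y} hB1) fun hβ => by
      have h := setIntegral_mono_on (integrable_const ((1 + t) * α)).integrableOn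
        hInt.integrableOn hB1 fun y hy => hy
      rw [setIntegral_const, smul_eq_mul] at h
      refine le_abs.mpr (Or.inl ?_)
      rw [le_sub_iff_add_le, le_div_iff₀ (mul_pos hα hβ)]
      linarith
  have h2 := measureReal_le_two_mul_exp hn hα hα1 measureReal_nonneg ht1
    (hL {y | m y ≤ (1 - t) * α} hB2) fun hβ => by
      have h := setIntegral_mono_on hInt.integrableOn
        (integrable_const ((1 - t) * α)).integrableOn hB2 fun y hy => hy
      rw [setIntegral_const, smul_eq_mul] at h
      refine le_abs.mpr (Or.inr ?_)
      have : (∫ y in {y | m y ≤ (1 - t) * α}, m y ∂uSphere n) /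
          (α * (uSphere n).real {y | m y ≤ (1 - t) * α}) ≤ 1 - t := by
        rw [div_le_iff₀ (mul_pos hα hβ)]
        linarith
      linarith
  calc _ ≤ _ := measureReal_mono hsub
    _ ≤ _ := measureReal_union_le _ _
    _ ≤ _ := by linarith

end EquatorSampling

/-- Equator sampling theorem: there are universal constants `C, c > 0` such that for any
measurable `A ⊆ S^{n-1}` of positive measure and any `0 < t < 1`, a uniformly random
hyperplane `H = y^⊥` (for `y` uniform on the sphere) satisfies
`|σ_H(A ∩ H)/σ(A) - 1| ≥ t` with probability at most `C exp(-cnt/log(2/σ(A)))`.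
Here `m y = σ_{y^⊥}(A ∩ y^⊥)` is characterized through any isometric parametrization
`e : ℝ^{n-1} → ℝⁿ` of the hyperplane `y^⊥`. -/
theorem equator_sampling :
    ∃ C : ℝ, 0 < C ∧ ∃ c : ℝ, 0 < c ∧
      ∀ (n : ℕ) (_ : 2 ≤ n) (A : Set (sphere (0 : EuclideanSpace ℝ (Fin n)) 1)),
        MeasurableSet A → 0 < (uSphere n A).toReal →
        ∀ t : ℝ, 0 < t → t < 1 →
        ∀ m : sphere (0 : EuclideanSpace ℝ (Fin n)) 1 → ℝ,
        (∀ (y : sphere (0 : EuclideanSpace ℝ (Fin n)) 1)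
            (e : EuclideanSpace ℝ (Fin (n - 1)) →ₗᵢ[ℝ] EuclideanSpace ℝ (Fin n)),
          LinearMap.range e.toLinearMap
              = (Submodule.span ℝ {(y : EuclideanSpace ℝ (Fin n))})ᗮ →
          m y = (uSphere (n - 1) {ω | sphereMap e ω ∈ A}).toReal) →
        (uSphere n {y | t ≤ |m y / (uSphere n A).toReal - 1|}).toReal
          ≤ C * Real.exp (-(c * n * t) / Real.log (2 / (uSphere n A).toReal)) := by
  refine ⟨4, by norm_num, 1 / 70000, by norm_num, fun n hn A hA hα t ht0 ht1 m hm => ?_⟩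
  have : NeZero n := ⟨by omega⟩
  rcases hn.eq_or_lt with rfl | hn
  · have ha := half_le_log_two_div hα (measureReal_le_one (μ := uSphere 2) (s := A))
    set a := Real.log (2 / (uSphere 2 A).toReal)
    have h1 : -1 ≤ -(1 / 70000 * (2 : ℕ) * t) / a := by
      rw [le_div_iff₀ (by linarith)]
      push_cast
      linarith
    have h2 : 1 / 4 ≤ Real.exp (-1) := by
      rw [Real.exp_neg, ← one_div]
      exact one_div_le_one_div_of_le (Real.exp_pos 1) (by linarith [Real.exp_one_lt_d9])
    exact measureReal_le_one.trans (by linarith [Real.exp_le_exp.mpr h1])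
  · exact measureReal_abs_div_sub_one_le hn hA hα hm ht1
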